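/- Let R be a 4-dimensional Noetherian local ring whose m-adic completion is a UFD, I an ideal of R, and M a finitely generated R-module. Then for every finitely generated R-module N with Supp_R N ⊆ V(I), the set Ass_R Ext^i_R(N, H^j_I(M)) is finite for all i, j ≥ 0. In particular, Ass_R H^i_I(M) is finite for all i. -/

import Mathlib

open CategoryTheory

noncomputable section

universe u

/-- The Krull dimension of a module: `dim R/ann(M)`. -/
def moduleDim (R : Type u) [CommRing R] (M : Type*) [AddCommGroup M] [Module R M] :
    WithBot (WithTop ℕ) :=
  ringKrullDim (R ⧸ Module.annihilator R M)

/-- The depth of `M` with respect to an ideal `J`: the supremum of the lengths of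
`M`-regular sequences consisting of elements of `J`. -/
def moduleDepth (R : Type u) [CommRing R] (J : Ideal R) (M : Type*) [AddCommGroup M]
    [Module R M] : ℕ∞ :=
  sSup {n : ℕ∞ | ∃ rs : List R, (rs.length : ℕ∞) = n ∧ (∀ r ∈ rs, r ∈ J) ∧
    RingTheory.Sequence.IsRegular M rs}

/-- Serre's condition `S_ℓ` : for every prime `p` in the support of `M`,
`depth M_p ≥ min (ℓ, dim M_p)`. -/
def SerreCondition (R : Type u) [CommRing R] (ℓ : ℕ) (M : Type u) [AddCommGroup M]
    [Module R M] : Prop :=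
  ∀ p ∈ Module.support R M,
    min ((ℓ : ℕ∞) : WithBot ℕ∞)
        (moduleDim (Localization.AtPrime p.asIdeal) (LocalizedModule p.asIdeal.primeCompl M)) ≤
      ((moduleDepth (Localization.AtPrime p.asIdeal)
          (IsLocalRing.maximalIdeal (Localization.AtPrime p.asIdeal))
          (LocalizedModule p.asIdeal.primeCompl M) : ℕ∞) : WithBot ℕ∞)

/-- A module `N` over `S` is `J`-cofinite if its support is contained in `V(J)` and all the
modules `Ext^i_S(S/J, N)` are finitely generated. -/
def IsCofinite (S : Type u) [CommRing S] (J : Ideal S) (N : ModuleCat.{u} S) : Prop :=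
  Module.support S N ⊆ PrimeSpectrum.zeroLocus (J : Set S) ∧
  ∀ i : ℕ, Module.Finite S
    (((Ext S (ModuleCat.{u} S) i).obj (Opposite.op (ModuleCat.of S (S ⧸ J)))).obj N)

/-- A ring is catenary if any two saturated chains of primes with the same endpoints have
the same length. -/
def IsCatenaryRing (R : Type u) [CommRing R] : Prop :=
  ∀ c₁ c₂ : LTSeries (PrimeSpectrum R),
    c₁.head = c₂.head → c₁.last = c₂.last →
    (∀ i : Fin c₁.length, c₁.toFun i.castSucc ⋖ c₁.toFun i.succ) →
    (∀ i : Fin c₂.length, c₂.toFun i.castSucc ⋖ c₂.toFun i.succ) →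
    c₁.length = c₂.length

/-- A module is indecomposable if it is nonzero and is not the internal direct sum of two
nonzero submodules. -/
def ModuleIndecomposable (R : Type u) [CommRing R] (M : Type*) [AddCommGroup M]
    [Module R M] : Prop :=
  Nontrivial M ∧ ∀ N₁ N₂ : Submodule R M, IsCompl N₁ N₂ → N₁ = ⊥ ∨ N₂ = ⊥

/-- A module is equidimensional if `dim R/P = dim M` for every minimal prime `P`
of its support (equivalently, of its annihilator). -/
def Equidimensional (R : Type u) [CommRing R] (M : Type*) [AddCommGroup M]
    [Module R M] : Prop :=
  ∀ P ∈ (Module.annihilator R M).minimalPrimes, ringKrullDim (R ⧸ P) = moduleDim R M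

/-- A local ring is Cohen-Macaulay if its depth equals its Krull dimension. -/
def IsCMLocalRing (S : Type u) [CommRing S] [IsLocalRing S] : Prop :=
  ((moduleDepth S (IsLocalRing.maximalIdeal S) S : ℕ∞) : WithBot ℕ∞) = ringKrullDim S

/-- A ring is Cohen-Macaulay if all its localizations at primes are Cohen-Macaulay local
rings. -/
def IsCMRing (S : Type u) [CommRing S] : Prop :=
  ∀ p : PrimeSpectrum S, IsCMLocalRing (Localization.AtPrime p.asIdeal)

section Comparison
variable {R : Type u} [CommRing R]

/-- The class of a cocycle in the homology of a short complex in the opposite category. -/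
def unopHomologyMk (S : ShortComplex (ModuleCat.{u} R)ᵒᵖ) :
    LinearMap.ker S.unop.g.hom →ₗ[R] ↥(Opposite.unop S.homology) :=
  (S.unop.moduleCatCyclesIso.inv ≫ S.unop.homologyπ ≫ S.unop.homologyOpIso.hom.unop).hom

lemma unopHomologyMk_surjective (S : ShortComplex (ModuleCat.{u} R)ᵒᵖ) :
    Function.Surjective (unopHomologyMk S) := by
  have : Epi (S.unop.moduleCatCyclesIso.inv ≫ S.unop.homologyπ ≫
      S.unop.homologyOpIso.hom.unop) := by infer_instance
  exact (ModuleCat.epi_iff_surjective _).1 this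

lemma unopHomologyMk_eq_zero_iff (S : ShortComplex (ModuleCat.{u} R)ᵒᵖ)
    (z : LinearMap.ker S.unop.g.hom) :
    unopHomologyMk S z = 0 ↔ ∃ w, S.unop.f.hom w = z.1 := by
  have h : Function.Injective (S.unop.homologyOpIso.hom.unop).hom :=
    (ModuleCat.mono_iff_injective _).1 inferInstance
  have h2 : Function.Injective (S.unop.moduleCatHomologyIso.inv).hom :=
    (ModuleCat.mono_iff_injective _).1 inferInstance
  have e : unopHomologyMk S z = (S.unop.homologyOpIso.hom.unop).hom
      ((S.unop.moduleCatCyclesIso.inv ≫ S.unop.homologyπ).hom z) := rfl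
  rw [e, S.unop.moduleCatCyclesIso_inv_π]
  change (S.unop.homologyOpIso.hom.unop).hom ((S.unop.moduleCatHomologyIso.inv).hom
    (S.unop.moduleCatLeftHomologyData.π.hom z)) = 0 ↔ _
  rw [map_eq_zero_iff _ h, map_eq_zero_iff _ h2]
  change Submodule.Quotient.mk (p := LinearMap.range S.unop.moduleCatToCycles) z = 0 ↔ _
  rw [Submodule.Quotient.mk_eq_zero]
  constructor
  · rintro ⟨w, rfl⟩
    exact ⟨w, rfl⟩
  · rintro ⟨w, hw⟩
    exact ⟨w, Subtype.ext hw⟩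

lemma unopHomologyMk_naturality {S₁ S₂ : ShortComplex (ModuleCat.{u} R)ᵒᵖ} (φ : S₁ ⟶ S₂)
    (z : LinearMap.ker S₂.unop.g.hom) (z' : LinearMap.ker S₁.unop.g.hom)
    (hz : φ.τ₂.unop.hom z.1 = z'.1) :
    (ShortComplex.homologyMap φ).unop.hom (unopHomologyMk S₂ z) = unopHomologyMk S₁ z' := by
  have hc : (ShortComplex.cyclesMap (ShortComplex.unopMap φ)).hom
      (S₂.unop.moduleCatCyclesIso.inv.hom z) = S₁.unop.moduleCatCyclesIso.inv.hom z' := by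
    have hi : Function.Injective S₁.unop.iCycles.hom :=
      (ModuleCat.mono_iff_injective _).1 inferInstance
    apply hi
    have e1 := ConcreteCategory.congr_hom (ShortComplex.cyclesMap_i (ShortComplex.unopMap φ))
      (S₂.unop.moduleCatCyclesIso.inv.hom z)
    have e2 := ConcreteCategory.congr_hom (S₂.unop.moduleCatCyclesIso_inv_iCycles) z
    have e3 := ConcreteCategory.congr_hom (S₁.unop.moduleCatCyclesIso_inv_iCycles) z'
    refine e1.trans ?_
    refine Eq.trans ?_ e3.symm
    refine (congrArg φ.τ₂.unop.hom e2).trans hz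
  have hn := ShortComplex.homologyOpIso_hom_naturality (ShortComplex.unopMap φ)
  have hn' := congrArg Quiver.Hom.unop hn
  have e4 := ConcreteCategory.congr_hom hn'
    (S₂.unop.homologyπ.hom (S₂.unop.moduleCatCyclesIso.inv.hom z))
  have e5 := ConcreteCategory.congr_hom (ShortComplex.homologyπ_naturality (ShortComplex.unopMap φ))
    (S₂.unop.moduleCatCyclesIso.inv.hom z)
  refine e4.trans ?_
  refine (congrArg S₁.unop.homologyOpIso.hom.unop.hom (e5.trans
    (congrArg S₁.unop.homologyπ.hom hc)))

end Comparison

section Comparison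
variable {R : Type u} [CommRing R]

/-- Cocycles of degree `n` with values in `Y` of a projective resolution. -/
def extCocycles {X : ModuleCat.{u} R} (P : ProjectiveResolution X) (Y : ModuleCat.{u} R) (n : ℕ) :
    Submodule R (P.complex.X n ⟶ Y) :=
  LinearMap.ker (Linear.leftComp R Y (P.complex.d (n + 1) n))

lemma mem_extCocycles {X : ModuleCat.{u} R} (P : ProjectiveResolution X) (Y : ModuleCat.{u} R)
    (n : ℕ) (f : P.complex.X n ⟶ Y) :
    f ∈ extCocycles P Y n ↔ P.complex.d (n + 1) n ≫ f = 0 := Iff.rfl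

/-- The short complex in the opposite category whose homology computes the derived functor. -/
abbrev extShortComplex {X : ModuleCat.{u} R} (P : ProjectiveResolution X) (Y : ModuleCat.{u} R)
    (n : ℕ) : ShortComplex (ModuleCat.{u} R)ᵒᵖ :=
  ((((linearYoneda R (ModuleCat.{u} R)).obj Y).rightOp.mapHomologicalComplex
    (ComplexShape.down ℕ)).obj P.complex).sc n

lemma mem_ker_extShortComplex_g {X : ModuleCat.{u} R} (P : ProjectiveResolution X)
    (Y : ModuleCat.{u} R) (n : ℕ) (f : P.complex.X n ⟶ Y) :
    (extShortComplex P Y n).unop.g.hom f = 0 ↔ f ∈ extCocycles P Y n := by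
  have h : ∀ k, k = n + 1 → (P.complex.d k n ≫ f = 0 ↔ P.complex.d (n + 1) n ≫ f = 0) := by
    rintro k rfl
    rfl
  exact h _ (ChainComplex.prev ℕ n)

/-- The class of a cocycle in the Ext module defined by deriving the Hom functor. -/
def leftDerivedExtMk {X : ModuleCat.{u} R} (P : ProjectiveResolution X) (Y : ModuleCat.{u} R)
    (n : ℕ) : extCocycles P Y n →ₗ[R]
      ↥(((Ext R (ModuleCat.{u} R) n).obj (Opposite.op X)).obj Y) :=
  (P.isoLeftDerivedObj ((linearYoneda R (ModuleCat.{u} R)).obj Y).rightOp n).hom.unop.hom ∘ₗ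
    unopHomologyMk (extShortComplex P Y n) ∘ₗ
    Submodule.inclusion (show extCocycles P Y n ≤
        LinearMap.ker (extShortComplex P Y n).unop.g.hom from fun f hf =>
      (mem_ker_extShortComplex_g P Y n f).2 hf)

lemma leftDerivedExtMk_surjective {X : ModuleCat.{u} R} (P : ProjectiveResolution X)
    (Y : ModuleCat.{u} R) (n : ℕ) : Function.Surjective (leftDerivedExtMk P Y n) := by
  intro x
  obtain ⟨y, rfl⟩ := (ModuleCat.epi_iff_surjective (P.isoLeftDerivedObj
    ((linearYoneda R (ModuleCat.{u} R)).obj Y).rightOp n).hom.unop).1 inferInstance x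
  obtain ⟨⟨f, hf⟩, rfl⟩ := unopHomologyMk_surjective (extShortComplex P Y n) y
  exact ⟨⟨f, (mem_ker_extShortComplex_g P Y n f).1 hf⟩, rfl⟩

lemma leftDerivedExtMk_eq_zero_iff {X : ModuleCat.{u} R} (P : ProjectiveResolution X)
    (Y : ModuleCat.{u} R) (n : ℕ) (z : extCocycles P Y n) :
    leftDerivedExtMk P Y n z = 0 ↔
      ∃ w, P.complex.d n ((ComplexShape.down ℕ).next n) ≫ w = z.1 := by
  have h : Function.Injective (P.isoLeftDerivedObj
    ((linearYoneda R (ModuleCat.{u} R)).obj Y).rightOp n).hom.unop.hom :=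
    (ModuleCat.mono_iff_injective _).1 inferInstance
  exact (map_eq_zero_iff _ h).trans (unopHomologyMk_eq_zero_iff _ _)

lemma leftDerivedExtMk_naturality {X X' : ModuleCat.{u} R} (P : ProjectiveResolution X)
    (P' : ProjectiveResolution X') (Y : ModuleCat.{u} R) (n : ℕ) (g : X' ⟶ X)
    (φ : ProjectiveResolution.Hom P' P g) (z : extCocycles P Y n) (z' : extCocycles P' Y n)
    (hz : φ.hom.f n ≫ z.1 = z'.1) :
    (((Ext R (ModuleCat.{u} R) n).map g.op).app Y).hom (leftDerivedExtMk P Y n z) =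
      leftDerivedExtMk P' Y n z' := by
  have h := ProjectiveResolution.isoLeftDerivedObj_hom_naturality g P' P φ.hom
    (by rw [φ.hom_f_zero_comp_π_f_zero, ChainComplex.single₀_map_f_zero]; rfl)
    ((linearYoneda R (ModuleCat.{u} R)).obj Y).rightOp n
  have h' := congrArg Quiver.Hom.unop h
  have e := ConcreteCategory.congr_hom h' (unopHomologyMk (extShortComplex P Y n)
    ⟨z.1, (mem_ker_extShortComplex_g P Y n z.1).2 z.2⟩)
  refine e.trans ?_
  refine congrArg (P'.isoLeftDerivedObj
    ((linearYoneda R (ModuleCat.{u} R)).obj Y).rightOp n).hom.unop.hom ?_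
  exact unopHomologyMk_naturality ((HomologicalComplex.shortComplexFunctor _ _ n).map
    ((((linearYoneda R (ModuleCat.{u} R)).obj Y).rightOp.mapHomologicalComplex _).map φ.hom))
    _ _ hz

/-- The class of a cocycle in the Ext module defined through the derived category. -/
def derivedExtMk {X : ModuleCat.{u} R} (P : ProjectiveResolution X) (Y : ModuleCat.{u} R)
    (n : ℕ) : extCocycles P Y n →ₗ[R] Abelian.Ext X Y n where
  toFun z := P.extMk z.1 (n + 1) rfl z.2
  map_add' z w := (P.add_extMk z.1 w.1 (n + 1) rfl z.2 w.2).symm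
  map_smul' r z := by
    rw [RingHom.id_apply, Abelian.Ext.smul_eq_comp_mk₀]
    refine Eq.trans ?_ (P.extMk_comp_mk₀ z.1 (n + 1) rfl z.2 (r • 𝟙 Y)).symm
    congr 1

lemma derivedExtMk_eq_zero_iff {X : ModuleCat.{u} R} (P : ProjectiveResolution X)
    (Y : ModuleCat.{u} R) (n : ℕ) (z : extCocycles P Y n) :
    derivedExtMk P Y n z = 0 ↔
      ∃ w, P.complex.d n ((ComplexShape.down ℕ).next n) ≫ w = z.1 := by
  change P.extMk z.1 (n + 1) rfl z.2 = 0 ↔ _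
  cases n with
  | zero =>
    have hd : P.complex.d 0 ((ComplexShape.down ℕ).next 0) = 0 := by
      apply P.complex.shape
      simp
    rw [hd]
    obtain ⟨f, hf⟩ := z
    rw [mem_extCocycles] at hf
    change P.extMk f 1 rfl hf = 0 ↔ ∃ w, _ = f
    constructor
    · intro h
      refine ⟨0, ?_⟩
      rw [Limits.zero_comp]
      rw [← P.extEquivCohomologyClass.apply_eq_iff_eq,
        ProjectiveResolution.extEquivCohomologyClass_extMk,
        ProjectiveResolution.extEquivCohomologyClass_zero,
        CochainComplex.HomComplex.CohomologyClass.mk_eq_zero_iff,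
        CochainComplex.HomComplex.Cocycle.toSingleMk_mem_coboundaries_iff _ _ _ _ _ 1 (by lia)] at h
      obtain ⟨g, hg⟩ := h
      have h0 : P.cochainComplex.d (-((0 : ℕ) : ℤ)) 1 = 0 :=
        (P.cochainComplex.isZero_of_isStrictlyLE 0 1 (by lia)).eq_of_tgt _ _
      rw [h0, Limits.zero_comp] at hg
      rw [← cancel_epi (P.cochainComplexXIso (-((0 : ℕ) : ℤ)) 0 rfl).hom, ← hg,
        Limits.comp_zero]
    · rintro ⟨w, hw⟩
      rw [Limits.zero_comp] at hw
      have := P.extMk_zero (Y := Y) 1 rfl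
      simp only [← hw]
      exact this
  | succ p =>
    rw [P.extMk_eq_zero_iff z.1 (p + 1 + 1) rfl z.2 p rfl]
    have h : ∀ k, k = p → ((∃ w : P.complex.X p ⟶ Y, P.complex.d (p + 1) p ≫ w = z.1) ↔
        ∃ w : P.complex.X k ⟶ Y, P.complex.d (p + 1) k ≫ w = z.1) := by
      rintro k rfl
      rfl
    exact h _ (ChainComplex.next_nat_succ p)

lemma derivedExtMk_surjective {X : ModuleCat.{u} R} (P : ProjectiveResolution X)
    (Y : ModuleCat.{u} R) (n : ℕ) : Function.Surjective (derivedExtMk P Y n) := by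
  intro α
  obtain ⟨f, hf, rfl⟩ := P.extMk_surjective α (n + 1) rfl
  exact ⟨⟨f, hf⟩, rfl⟩

lemma derivedExtMk_naturality {X X' : ModuleCat.{u} R} (P : ProjectiveResolution X)
    (P' : ProjectiveResolution X') (Y : ModuleCat.{u} R) (n : ℕ) (g : X' ⟶ X)
    (φ : ProjectiveResolution.Hom P' P g) (z : extCocycles P Y n) (z' : extCocycles P' Y n)
    (hz : φ.hom.f n ≫ z.1 = z'.1) :
    (Abelian.Ext.mk₀ g).comp (derivedExtMk P Y n z) (zero_add n) = derivedExtMk P' Y n z' := by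
  refine (ProjectiveResolution.mk₀_comp_extMk z.1 (n + 1) rfl z.2 φ).trans ?_
  obtain ⟨z', hz'⟩ := z'
  obtain rfl : φ.hom.f n ≫ z.1 = z' := hz
  rfl

/-- Two surjections out of the same module with the same kernel have isomorphic targets. -/
def LinearMap.equivOfKerEq {A B C : Type*} [AddCommGroup A] [AddCommGroup B] [AddCommGroup C]
    [Module R A] [Module R B] [Module R C] (f : A →ₗ[R] B) (g : A →ₗ[R] C)
    (hf : Function.Surjective f) (hg : Function.Surjective g)
    (h : LinearMap.ker f = LinearMap.ker g) : B ≃ₗ[R] C :=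
  (f.quotKerEquivOfSurjective hf).symm ≪≫ₗ Submodule.quotEquivOfEq _ _ h ≪≫ₗ
    g.quotKerEquivOfSurjective hg

lemma LinearMap.equivOfKerEq_apply {A B C : Type*} [AddCommGroup A] [AddCommGroup B]
    [AddCommGroup C] [Module R A] [Module R B] [Module R C] (f : A →ₗ[R] B) (g : A →ₗ[R] C)
    (hf : Function.Surjective f) (hg : Function.Surjective g)
    (h : LinearMap.ker f = LinearMap.ker g) (a : A) :
    LinearMap.equivOfKerEq f g hf hg h (f a) = g a := by
  have : (f.quotKerEquivOfSurjective hf).symm (f a) = Submodule.Quotient.mk a := by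
    rw [LinearEquiv.symm_apply_eq]
    rfl
  simp only [LinearMap.equivOfKerEq, LinearEquiv.trans_apply, this]
  rfl

/-- The two definitions of Ext in Mathlib agree. -/
def leftDerivedExtEquiv (X Y : ModuleCat.{u} R) (n : ℕ) :
    ↥(((Ext R (ModuleCat.{u} R) n).obj (Opposite.op X)).obj Y) ≃ₗ[R] Abelian.Ext X Y n :=
  LinearMap.equivOfKerEq (leftDerivedExtMk (projectiveResolution X) Y n)
    (derivedExtMk (projectiveResolution X) Y n) (leftDerivedExtMk_surjective _ _ _)
    (derivedExtMk_surjective _ _ _) (by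
      ext z
      rw [LinearMap.mem_ker, LinearMap.mem_ker, leftDerivedExtMk_eq_zero_iff,
        derivedExtMk_eq_zero_iff])

lemma leftDerivedExtEquiv_naturality {X X' : ModuleCat.{u} R} (g : X' ⟶ X) (Y : ModuleCat.{u} R)
    (n : ℕ) (x : ↥(((Ext R (ModuleCat.{u} R) n).obj (Opposite.op X)).obj Y)) :
    leftDerivedExtEquiv X' Y n ((((Ext R (ModuleCat.{u} R) n).map g.op).app Y).hom x) =
      (Abelian.Ext.mk₀ g).comp (leftDerivedExtEquiv X Y n x) (zero_add n) := by
  obtain ⟨z, rfl⟩ := leftDerivedExtMk_surjective (projectiveResolution X) Y n x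
  let φ : ProjectiveResolution.Hom (projectiveResolution X') (projectiveResolution X) g :=
    { hom := ProjectiveResolution.lift g _ _
      hom_f_zero_comp_π_f_zero := by
        rw [← HomologicalComplex.comp_f, ProjectiveResolution.lift_commutes,
          HomologicalComplex.comp_f] }
  have hz' : φ.hom.f n ≫ z.1 ∈ extCocycles (projectiveResolution X') Y n := by
    rw [mem_extCocycles, ← φ.hom.comm_assoc, (mem_extCocycles _ _ _ _).1 z.2, Limits.comp_zero]
  rw [leftDerivedExtMk_naturality _ (projectiveResolution X') Y n g φ z ⟨_, hz'⟩ rfl]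
  simp only [leftDerivedExtEquiv, LinearMap.equivOfKerEq_apply]
  exact (derivedExtMk_naturality _ (projectiveResolution X') Y n g φ z ⟨_, hz'⟩ rfl).symm

end Comparison

section TorsionColimit
open Abelian
variable {R : Type u} [CommRing R]

/-- The projection `R / I ^ s ⟶ R / I ^ t` for `t ≤ s`. -/
abbrev powQuotientMap (I : Ideal R) {t s : ℕ} (h : t ≤ s) :
    ModuleCat.of R (R ⧸ I ^ s) ⟶ ModuleCat.of R (R ⧸ I ^ t) :=
  ModuleCat.ofHom (Submodule.mapQ _ _ LinearMap.id (Ideal.pow_le_pow_right h))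

lemma powQuotientMap_self (I : Ideal R) (t : ℕ) : powQuotientMap I (le_refl t) = 𝟙 _ := by
  ext
  rfl

lemma powQuotientMap_comp (I : Ideal R) {t s r : ℕ} (h : t ≤ s) (h' : s ≤ r) :
    powQuotientMap I h' ≫ powQuotientMap I h = powQuotientMap I (h.trans h') := by
  ext
  rfl

/-- Precomposition with a morphism, as a linear map between Ext modules. -/
def extPrecomp {N N' : ModuleCat.{u} R} (f : N' ⟶ N) (X : ModuleCat.{u} R) (i : ℕ) :
    Ext N X i →ₗ[R] Ext N' X i :=
  Ext.bilinearCompOfLinear R N' N X 0 i i (zero_add i) (Ext.mk₀ f)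

lemma extPrecomp_apply {N N' : ModuleCat.{u} R} (f : N' ⟶ N) (X : ModuleCat.{u} R) (i : ℕ)
    (e : Ext N X i) : extPrecomp f X i e = (Ext.mk₀ f).comp e (zero_add i) := rfl

/-- Postcomposition with an extension class, as a linear map between Ext modules. -/
def extPostcomp (N : ModuleCat.{u} R) {X Y : ModuleCat.{u} R} {d j k : ℕ} (α : Ext X Y d)
    (h : j + d = k) : Ext N X j →ₗ[R] Ext N Y k :=
  (Ext.bilinearCompOfLinear R N X Y j d k h).flip α

lemma extPostcomp_apply (N : ModuleCat.{u} R) {X Y : ModuleCat.{u} R} {d j k : ℕ} (α : Ext X Y d)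
    (h : j + d = k) (e : Ext N X j) : extPostcomp N α h e = e.comp α h := rfl

/-- The transition maps of the system of Ext modules out of `R / I ^ t`. -/
abbrev powExtMap (I : Ideal R) (j : ℕ) (X : ModuleCat.{u} R) (t s : ℕ) (h : t ≤ s) :
    Ext (ModuleCat.of R (R ⧸ I ^ t)) X j →ₗ[R] Ext (ModuleCat.of R (R ⧸ I ^ s)) X j :=
  extPrecomp (powQuotientMap I h) X j

instance powExt_directedSystem (I : Ideal R) (j : ℕ) (X : ModuleCat.{u} R) :
    DirectedSystem (fun t : ℕ => Ext (ModuleCat.of R (R ⧸ I ^ t)) X j)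
      (fun t s h => powExtMap I j X t s h) where
  map_self t x := by
    simp [powQuotientMap_self, extPrecomp_apply]
  map_map t s r h h' x := by
    simp [extPrecomp_apply, Ext.mk₀_comp_mk₀_assoc, powQuotientMap_comp]

/-- Local cohomology as the direct limit of the modules `Ext (R / I ^ t) X j`. -/
def loc (I : Ideal R) (j : ℕ) (X : ModuleCat.{u} R) : ModuleCat.{u} R :=
  ModuleCat.of R (Module.DirectLimit (fun t : ℕ => Ext (ModuleCat.of R (R ⧸ I ^ t)) X j)
    (powExtMap I j X))

/-- The structure map of the direct limit defining local cohomology. -/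
def toLoc (I : Ideal R) (j : ℕ) (X : ModuleCat.{u} R) (t : ℕ) :
    Ext (ModuleCat.of R (R ⧸ I ^ t)) X j →ₗ[R] loc I j X :=
  Module.DirectLimit.of R ℕ _ (powExtMap I j X) t

lemma exists_toLoc {I : Ideal R} {j : ℕ} {X : ModuleCat.{u} R} (x : loc I j X) :
    ∃ t e, toLoc I j X t e = x :=
  Module.DirectLimit.exists_of x

lemma toLoc_powExtMap {I : Ideal R} {j : ℕ} {X : ModuleCat.{u} R} {t s : ℕ} (h : t ≤ s)
    (e : Ext (ModuleCat.of R (R ⧸ I ^ t)) X j) :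
    toLoc I j X s (powExtMap I j X t s h e) = toLoc I j X t e :=
  Module.DirectLimit.of_f

lemma exists_of_toLoc_eq_zero {I : Ideal R} {j : ℕ} {X : ModuleCat.{u} R} {t : ℕ}
    {e : Ext (ModuleCat.of R (R ⧸ I ^ t)) X j} (h : toLoc I j X t e = 0) :
    ∃ s, ∃ h : t ≤ s, powExtMap I j X t s h e = 0 :=
  Module.DirectLimit.of.zero_exact h

lemma powExtMap_comp (I : Ideal R) {X Y : ModuleCat.{u} R} {d j k : ℕ} (α : Ext X Y d)
    (h : j + d = k) {t s : ℕ} (hts : t ≤ s) (e : Ext (ModuleCat.of R (R ⧸ I ^ t)) X j) :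
    powExtMap I k Y t s hts (e.comp α h) = (powExtMap I j X t s hts e).comp α h := by
  simp only [extPrecomp_apply]
  exact (Ext.comp_assoc _ _ _ _ _ (by lia)).symm

/-- The map on local cohomology induced by an extension class. -/
def locMap (I : Ideal R) {X Y : ModuleCat.{u} R} {d j k : ℕ} (α : Ext X Y d) (h : j + d = k) :
    loc I j X →ₗ[R] loc I k Y :=
  Module.DirectLimit.map (fun t => extPostcomp (ModuleCat.of R (R ⧸ I ^ t)) α h)
    (fun _ _ hts => LinearMap.ext fun e => (powExtMap_comp I α h hts e).symm)

lemma locMap_toLoc (I : Ideal R) {X Y : ModuleCat.{u} R} {d j k : ℕ} (α : Ext X Y d)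
    (h : j + d = k) (t : ℕ) (e : Ext (ModuleCat.of R (R ⧸ I ^ t)) X j) :
    locMap I α h (toLoc I j X t e) = toLoc I k Y t (e.comp α h) :=
  Module.DirectLimit.map_apply_of _ _ _

lemma locMap_comp (I : Ideal R) {X Y Z : ModuleCat.{u} R} {d d' d'' j k l : ℕ} (α : Ext X Y d)
    (β : Ext Y Z d') (h : j + d = k) (h' : k + d' = l) (h'' : d + d' = d'') (x : loc I j X) :
    locMap I β h' (locMap I α h x) = locMap I (α.comp β h'') (by lia) x := by
  obtain ⟨t, e, rfl⟩ := exists_toLoc x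
  simp only [locMap_toLoc]
  congr 1
  exact Ext.comp_assoc _ _ _ _ _ (by lia)

lemma locMap_zero (I : Ideal R) {X Y : ModuleCat.{u} R} {d j k : ℕ}
    (h : j + d = k) (x : loc I j X) : locMap I (0 : Ext X Y d) h x = 0 := by
  obtain ⟨t, e, rfl⟩ := exists_toLoc x
  rw [locMap_toLoc, Ext.comp_zero, map_zero]

lemma exact_of_levelwise (I : Ideal R) {X Y Z : ModuleCat.{u} R} {d d' j k l : ℕ} (α : Ext X Y d)
    (β : Ext Y Z d') (h : j + d = k) (h' : k + d' = l) (h0 : α.comp β rfl = 0)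
    (H : ∀ (A : ModuleCat.{u} R) (y : Ext A Y k), y.comp β h' = 0 → ∃ x : Ext A X j,
      x.comp α h = y) :
    Function.Exact (locMap I α h) (locMap I β h') := by
  intro y
  constructor
  · intro hy
    obtain ⟨t, e, rfl⟩ := exists_toLoc y
    rw [locMap_toLoc] at hy
    obtain ⟨s, hs, hz⟩ := exists_of_toLoc_eq_zero hy
    rw [powExtMap_comp] at hz
    obtain ⟨x, hx⟩ := H _ _ hz
    refine ⟨toLoc I j X s x, ?_⟩
    rw [locMap_toLoc, hx, toLoc_powExtMap]
  · rintro ⟨x, rfl⟩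
    rw [locMap_comp I α β h h' rfl, h0, locMap_zero]

/-- The functoriality of local cohomology. -/
abbrev locHom (I : Ideal R) {X Y : ModuleCat.{u} R} (f : X ⟶ Y) (j : ℕ) :
    loc I j X →ₗ[R] loc I j Y := locMap I (Ext.mk₀ f) (add_zero j)

/-- The connecting homomorphism of local cohomology. -/
abbrev locδ (I : Ideal R) {S : ShortComplex (ModuleCat.{u} R)} (hS : S.ShortExact) (j : ℕ) :
    loc I j S.X₃ →ₗ[R] loc I (j + 1) S.X₁ := locMap I hS.extClass rfl

lemma loc_exact₂ (I : Ideal R) {S : ShortComplex (ModuleCat.{u} R)} (hS : S.ShortExact) (j : ℕ) :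
    Function.Exact (locHom I S.f j) (locHom I S.g j) :=
  exact_of_levelwise I _ _ _ _ (by simp) fun A y hy => Ext.covariant_sequence_exact₂ A hS y hy

lemma loc_exact₃ (I : Ideal R) {S : ShortComplex (ModuleCat.{u} R)} (hS : S.ShortExact) (j : ℕ) :
    Function.Exact (locHom I S.g j) (locδ I hS j) :=
  exact_of_levelwise I _ _ _ _ (by simp) fun A y hy =>
    Ext.covariant_sequence_exact₃ A hS y rfl hy

lemma loc_exact₁ (I : Ideal R) {S : ShortComplex (ModuleCat.{u} R)} (hS : S.ShortExact) (j : ℕ) :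
    Function.Exact (locδ I hS j) (locHom I S.f (j + 1)) :=
  exact_of_levelwise I _ _ _ _ (by simp) fun A y hy =>
    Ext.covariant_sequence_exact₁ A hS y hy rfl

/-- Local cohomology as defined in Mathlib is the direct limit `loc`. -/
lemma nonempty_localCohomology_equiv (I : Ideal R) (j : ℕ) (X : ModuleCat.{u} R) :
    Nonempty (loc I j X ≃ₗ[R] ↥((localCohomology I j).obj X)) := by
  let D := localCohomology.diagram (localCohomology.idealPowersDiagram I) j
  let G := (evaluation (ModuleCat.{u} R) (ModuleCat.{u} R)).obj X
  let c := G.mapCocone (Limits.colimit.cocone D)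
  have hc : Limits.IsColimit c := Limits.isColimitOfPreserves G (Limits.colimit.isColimit D)
  let o : ℕ → ℕᵒᵖᵒᵖ := fun t => Opposite.op (Opposite.op t)
  let m : ∀ {t s : ℕ}, t ≤ s → (o t ⟶ o s) := fun h => (homOfLE h).op.op
  let ι : ∀ t, Ext (ModuleCat.of R (R ⧸ I ^ t)) X j →ₗ[R] c.pt := fun t =>
    (c.ι.app (o t)).hom ∘ₗ (leftDerivedExtEquiv (ModuleCat.of R (R ⧸ I ^ t)) X j).symm.toLinearMap
  have hmap : ∀ (t s : ℕ) (h : t ≤ s) (e : Ext (ModuleCat.of R (R ⧸ I ^ t)) X j),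
      ((D ⋙ G).map (m h)).hom ((leftDerivedExtEquiv (ModuleCat.of R (R ⧸ I ^ t)) X j).symm e) =
      (leftDerivedExtEquiv (ModuleCat.of R (R ⧸ I ^ s)) X j).symm (powExtMap I j X t s h e) := by
    intro t s h e
    refine (LinearEquiv.eq_symm_apply _).2 ?_
    refine (leftDerivedExtEquiv_naturality (powQuotientMap I h) X j _).trans ?_
    rw [LinearEquiv.apply_symm_apply]
    rfl
  let F : loc I j X →ₗ[R] c.pt := Module.DirectLimit.lift R ℕ _ (powExtMap I j X) ι (by
    intro t s h e
    refine (congrArg (c.ι.app (o s)).hom (hmap t s h e).symm).trans ?_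
    exact ConcreteCategory.congr_hom (c.w (m h)) _)
  have hF : ∀ t e, F (toLoc I j X t e) = ι t e := fun t e => Module.DirectLimit.lift_of _ _ _
  have : Limits.PreservesFilteredColimitsOfSize.{0, 0} (forget (ModuleCat.{u} R)) :=
    Limits.preservesFilteredColimitsOfSize_shrink.{0, u, 0, u} _
  have : Limits.PreservesColimit (D ⋙ G) (forget (ModuleCat.{u} R)) := inferInstance
  refine ⟨LinearEquiv.ofBijective F ⟨?_, ?_⟩⟩
  · rw [← LinearMap.ker_eq_bot, LinearMap.ker_eq_bot']
    intro x hx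
    obtain ⟨t, e, rfl⟩ := exists_toLoc x
    rw [hF] at hx
    have h0 : ι t e = ι t 0 := by rw [hx, map_zero]
    obtain ⟨k, f, g, hfg⟩ := (Limits.Concrete.isColimit_rep_eq_iff_exists (D ⋙ G) hc _ _).1 h0
    have e1 : f = m (t := t) (s := k.unop.unop) f.unop.unop.le := Subsingleton.elim _ _
    have e2 : g = f := Subsingleton.elim _ _
    have h2 := hmap t k.unop.unop f.unop.unop.le e
    have h3 : ((D ⋙ G).map f).hom
      ((leftDerivedExtEquiv (ModuleCat.of R (R ⧸ I ^ t)) X j).symm e) = 0 := by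
      refine hfg.trans ?_
      change ((D ⋙ G).map g).hom ((leftDerivedExtEquiv _ X j).symm 0) = 0
      exact (congrArg ((D ⋙ G).map g).hom (map_zero _)).trans (map_zero _)
    have h4 : powExtMap I j X t k.unop.unop f.unop.unop.le e = 0 := by
      have := h2.symm.trans h3
      exact (LinearEquiv.map_eq_zero_iff _).1 this
    rw [← toLoc_powExtMap f.unop.unop.le, h4, map_zero]
  · intro y
    obtain ⟨k, e, rfl⟩ := Limits.Concrete.isColimit_exists_rep (D ⋙ G) hc y
    refine ⟨toLoc I j X k.unop.unop (leftDerivedExtEquiv _ X j e), ?_⟩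
    rw [hF]
    exact congrArg (c.ι.app k).hom ((leftDerivedExtEquiv _ X j).symm_apply_apply e)

end TorsionColimit

section SerreClasses
variable {R : Type*} [CommRing R] {A B C : Type*} [AddCommGroup A] [Module R A]
  [AddCommGroup B] [Module R B] [AddCommGroup C] [Module R C] {g : R}

/-- Every element is annihilated by a power of `g`. -/
def PowTorsion (g : R) (L : Type*) [AddCommGroup L] [Module R L] : Prop :=
  ∀ x : L, ∃ n : ℕ, g ^ n • x = 0

/-- The module is finitely generated up to `g`-power torsion. -/
def PowFinite (g : R) (L : Type*) [AddCommGroup L] [Module R L] : Prop :=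
  ∃ L₀ : Submodule R L, L₀.FG ∧ ∀ x : L, ∃ n : ℕ, g ^ n • x ∈ L₀

lemma PowTorsion.powFinite (h : PowTorsion g A) : PowFinite g A :=
  ⟨⊥, Submodule.fg_bot, fun x ↦ by simpa using h x⟩

lemma PowFinite.of_finite [Module.Finite R A] : PowFinite g A :=
  ⟨⊤, Module.Finite.fg_top, fun _ ↦ ⟨0, trivial⟩⟩

lemma PowTorsion.of_subsingleton [Subsingleton A] : PowTorsion g A :=
  fun _ ↦ ⟨0, Subsingleton.elim _ _⟩

lemma PowTorsion.of_exact_mod (f : A →ₗ[R] B) (h : B →ₗ[R] C)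
    (hex : ∀ b, h b = 0 → ∃ n : ℕ, g ^ n • b ∈ LinearMap.range f)
    (hA : PowTorsion g A) (hC : PowTorsion g C) : PowTorsion g B := by
  intro b
  obtain ⟨n, hn⟩ := hC (h b)
  obtain ⟨m, a, ha⟩ := hex (g ^ n • b) (by rw [map_smul, hn])
  obtain ⟨l, hl⟩ := hA a
  refine ⟨l + m + n, ?_⟩
  rw [pow_add, pow_add, mul_smul, mul_smul, ← ha, ← map_smul, hl, map_zero]

lemma PowFinite.of_exact_mod [IsNoetherianRing R] (f : A →ₗ[R] B) (h : B →ₗ[R] C)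
    (hex : ∀ b, h b = 0 → ∃ n : ℕ, g ^ n • b ∈ LinearMap.range f)
    (hA : PowFinite g A) (hC : PowFinite g C) : PowFinite g B := by
  obtain ⟨A₀, hA₀, hA⟩ := hA
  obtain ⟨C₀, hC₀, hC⟩ := hC
  have : (C₀ ⊓ LinearMap.range h).FG := hC₀.of_le inf_le_left
  obtain ⟨B₁, hB₁, hB₁C⟩ : ∃ B₁ : Submodule R B, B₁.FG ∧
      B₁.map h = C₀ ⊓ LinearMap.range h := by
    obtain ⟨S, hS⟩ := this
    have hSr : (S : Set C) ⊆ h '' Set.univ := by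
      intro c hc
      have : c ∈ C₀ ⊓ LinearMap.range h := hS ▸ Submodule.subset_span hc
      obtain ⟨b, hb⟩ := this.2
      exact ⟨b, trivial, hb⟩
    classical
    obtain ⟨T, -, hT⟩ := Finset.subset_set_image_iff.1 hSr
    refine ⟨Submodule.span R T, Submodule.fg_span T.finite_toSet, ?_⟩
    rw [Submodule.map_span, ← Finset.coe_image, hT, hS]
  refine ⟨A₀.map f ⊔ B₁, (hA₀.map f).sup hB₁, fun b ↦ ?_⟩
  obtain ⟨n, hn⟩ := hC (h b)
  have hmem : g ^ n • h b ∈ B₁.map h := hB₁C ▸ ⟨hn, g ^ n • b, map_smul _ _ _⟩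
  obtain ⟨b₁, hb₁, hb₁b⟩ := hmem
  obtain ⟨m, a, ha⟩ := hex (g ^ n • b - b₁) (by rw [map_sub, map_smul, hb₁b, sub_self])
  obtain ⟨l, hl⟩ := hA a
  refine ⟨l + m + n, ?_⟩
  have : g ^ (l + m + n) • b = f (g ^ l • a) + g ^ (l + m) • b₁ := by
    rw [map_smul, ha, pow_add, pow_add, mul_smul, mul_smul, mul_smul, smul_sub, smul_sub]
    abel
  rw [this]
  exact Submodule.add_mem_sup (Submodule.mem_map_of_mem hl) (B₁.smul_mem _ hb₁)

lemma PowTorsion.of_ker (h : B →ₗ[R] C) (hex : ∀ b, h b = 0 → ∃ n : ℕ, g ^ n • b = 0)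
    (hC : PowTorsion g C) : PowTorsion g B :=
  PowTorsion.of_exact_mod (A := PUnit.{1}) 0 h (by simpa using hex) .of_subsingleton hC

lemma PowTorsion.of_coker (f : A →ₗ[R] B) (hf : ∀ b, ∃ n : ℕ, g ^ n • b ∈ LinearMap.range f)
    (hA : PowTorsion g A) : PowTorsion g B :=
  PowTorsion.of_exact_mod (C := PUnit.{1}) f 0 (fun b _ ↦ hf b) hA .of_subsingleton

lemma PowTorsion.of_exact {f : A →ₗ[R] B} {h : B →ₗ[R] C} (hex : Function.Exact f h)
    (hA : PowTorsion g A) (hC : PowTorsion g C) : PowTorsion g B :=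
  PowTorsion.of_exact_mod f h (fun b hb ↦ ⟨0, by simpa using (hex b).1 hb⟩) hA hC

lemma PowTorsion.of_equiv (e : A ≃ₗ[R] B) (hA : PowTorsion g A) : PowTorsion g B :=
  PowTorsion.of_coker e.toLinearMap (fun b ↦ ⟨0, e.symm (g ^ 0 • b), by simp⟩) hA

variable [IsNoetherianRing R]

lemma PowFinite.of_ker (h : B →ₗ[R] C) (hex : ∀ b, h b = 0 → ∃ n : ℕ, g ^ n • b = 0)
    (hC : PowFinite g C) : PowFinite g B :=
  PowFinite.of_exact_mod (A := PUnit.{1}) 0 h (by simpa using hex)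
    (PowTorsion.of_subsingleton.powFinite) hC

lemma PowFinite.of_coker (f : A →ₗ[R] B) (hf : ∀ b, ∃ n : ℕ, g ^ n • b ∈ LinearMap.range f)
    (hA : PowFinite g A) : PowFinite g B :=
  PowFinite.of_exact_mod (C := PUnit.{1}) f 0 (fun b _ ↦ hf b) hA
    (PowTorsion.of_subsingleton.powFinite)

lemma PowFinite.of_exact {f : A →ₗ[R] B} {h : B →ₗ[R] C} (hex : Function.Exact f h)
    (hA : PowFinite g A) (hC : PowFinite g C) : PowFinite g B :=
  PowFinite.of_exact_mod f h (fun b hb ↦ ⟨0, by simpa using (hex b).1 hb⟩) hA hC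

lemma PowFinite.of_equiv (e : A ≃ₗ[R] B) (hA : PowFinite g A) : PowFinite g B :=
  PowFinite.of_coker e.toLinearMap (fun b ↦ ⟨0, e.symm (g ^ 0 • b), by simp⟩) hA

lemma PowFinite.finite_associatedPrimes (h : PowFinite g A) :
    {P ∈ associatedPrimes R A | g ∉ P}.Finite := by
  obtain ⟨A₀, hA₀, hA⟩ := h
  have : Module.Finite R A₀ := ⟨(Submodule.fg_top A₀).2 hA₀⟩
  refine (associatedPrimes.finite R A₀).subset ?_
  rintro P ⟨hP, hgP⟩
  rw [AssociatedPrimes.mem_iff, isAssociatedPrime_iff] at hP ⊢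
  obtain ⟨hPp, x, rfl⟩ := hP
  obtain ⟨n, hn⟩ := hA x
  refine ⟨hPp, ⟨_, hn⟩, ?_⟩
  ext r
  have key : r * g ^ n ∈ Submodule.colon (⊥ : Submodule R A) {x} ↔
      r ∈ Submodule.colon (⊥ : Submodule R A) {x} :=
    ⟨fun hr ↦ (hPp.mem_or_mem hr).resolve_right fun h ↦ hgP (hPp.mem_of_pow_mem n h),
      fun hr ↦ Ideal.mul_mem_right _ _ hr⟩
  rw [← key, Submodule.mem_colon_singleton, Submodule.mem_colon_singleton, Submodule.mem_bot,
    Submodule.mem_bot, ← Subtype.coe_inj]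
  simp [mul_smul]

end SerreClasses

section ExtPowFinite
open Abelian
variable {R : Type u} [CommRing R]

/-- The short complex attached to a short exact sequence of modules. -/
abbrev sesComplex {A B C : Type u} [AddCommGroup A] [Module R A] [AddCommGroup B] [Module R B]
    [AddCommGroup C] [Module R C] {f : A →ₗ[R] B} {h : B →ₗ[R] C} (hex : Function.Exact f h) :
    ShortComplex (ModuleCat.{u} R) :=
  ModuleCat.shortComplexOfCompEqZero f h hex.linearMap_comp_eq_zero

lemma sesComplex_shortExact {A B C : Type u} [AddCommGroup A] [Module R A] [AddCommGroup B]
    [Module R B] [AddCommGroup C] [Module R C] {f : A →ₗ[R] B} {h : B →ₗ[R] C}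
    (hex : Function.Exact f h) (hf : Function.Injective f) (hh : Function.Surjective h) :
    (sesComplex hex).ShortExact :=
  ModuleCat.shortComplex_shortExact (sesComplex hex) hex hf hh

section
variable (N : ModuleCat.{u} R) {S : ShortComplex (ModuleCat.{u} R)} (hS : S.ShortExact) (i : ℕ)

include hS in
lemma ext_exact₂ : Function.Exact (extPostcomp N (Ext.mk₀ S.f) (add_zero i))
    (extPostcomp N (Ext.mk₀ S.g) (add_zero i)) := by
  intro y
  refine ⟨fun hy ↦ Ext.covariant_sequence_exact₂ N hS y hy, ?_⟩
  rintro ⟨x, rfl⟩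
  simp [extPostcomp_apply]

lemma ext_exact₃ : Function.Exact (extPostcomp N (Ext.mk₀ S.g) (add_zero i))
    (extPostcomp N hS.extClass (rfl : i + 1 = i + 1)) := by
  intro y
  refine ⟨fun hy ↦ Ext.covariant_sequence_exact₃ N hS y rfl hy, ?_⟩
  rintro ⟨x, rfl⟩
  simp [extPostcomp_apply]

lemma ext_exact₁ : Function.Exact (extPostcomp N hS.extClass (rfl : i + 1 = i + 1))
    (extPostcomp N (Ext.mk₀ S.f) (add_zero (i + 1))) := by
  intro y
  refine ⟨fun hy ↦ Ext.covariant_sequence_exact₁ N hS y hy rfl, ?_⟩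
  rintro ⟨x, rfl⟩
  simp [extPostcomp_apply]

include hS in
lemma ext_zero_injective :
    Function.Injective (extPostcomp N (Ext.mk₀ S.f) (add_zero 0)) := by
  have := hS.mono_f
  exact Ext.postcomp_mk₀_injective_of_mono N S.f

end

variable (I : Ideal R) (g : R)

/-- All `Ext` modules from finite modules killed by a power of `I` into `X` are finitely
generated up to `g`-power torsion. -/
def ExtPowFinite (X : Type u) [AddCommGroup X] [Module R X] : Prop :=
  ∀ (N : Type u) [AddCommGroup N] [Module R N] [Module.Finite R N],
    (∃ k, I ^ k ≤ Module.annihilator R N) →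
      ∀ i, PowFinite g (Ext (ModuleCat.of R N) (ModuleCat.of R X) i)

variable {I g} {A B C : Type u} [AddCommGroup A] [Module R A] [AddCommGroup B] [Module R B]
    [AddCommGroup C] [Module R C]

section
variable [IsNoetherianRing R]

lemma ExtPowFinite.of_finite [Module.Finite R A] : ExtPowFinite I g A := by
  intro N _ _ _ _ i
  have := ModuleCat.finite_ext R (ModuleCat.of R N) (ModuleCat.of R A) i
  exact .of_finite

lemma powTorsion_ext (hA : PowTorsion g A) (i : ℕ) : ∀ (N : Type u) [AddCommGroup N] [Module R N]
    [Module.Finite R N], PowTorsion g (Ext (ModuleCat.of R N) (ModuleCat.of R A) i) := by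
  induction i with
  | zero =>
    intro N _ _ _ e
    have key : ∀ T : Submodule R N, T.FG → ∀ f : N →ₗ[R] A, ∃ n : ℕ, ∀ x ∈ T, g ^ n • f x = 0 := by
      intro T hT f
      induction T, hT using Submodule.fg_induction with
      | singleton x =>
        obtain ⟨n, hn⟩ := hA (f x)
        refine ⟨n, fun y hy ↦ ?_⟩
        obtain ⟨r, rfl⟩ := Submodule.mem_span_singleton.1 hy
        rw [map_smul, smul_comm, hn, smul_zero]
      | sup T₁ T₂ _ _ h₁ h₂ =>
        obtain ⟨n, hn⟩ := h₁
        obtain ⟨m, hm⟩ := h₂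
        refine ⟨n + m, fun y hy ↦ ?_⟩
        obtain ⟨y₁, h₁, y₂, h₂, rfl⟩ := Submodule.mem_sup.1 hy
        rw [map_add, smul_add, pow_add, mul_smul, mul_smul, hm y₂ h₂, smul_comm, hn y₁ h₁]
        simp
    let l := Ext.linearEquiv₀ (R := R) (X := ModuleCat.of R N) (Y := ModuleCat.of R A)
    obtain ⟨n, hn⟩ := key ⊤ Module.Finite.fg_top (l e).hom
    refine ⟨n, l.injective ?_⟩
    rw [map_smul, map_zero]
    ext x
    exact hn x trivial
  | succ i ih =>
    intro N _ _ _ e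
    obtain ⟨n, f, hf⟩ := Module.Finite.exists_fin' R N
    let e' : (ULift.{u} (Fin n) → R) ≃ₗ[R] (Fin n → R) :=
      LinearEquiv.funCongrLeft R R Equiv.ulift.symm
    let f' := f ∘ₗ e'.toLinearMap
    have hS := LinearMap.shortExact_shortComplexKer (f := f') (hf.comp e'.surjective)
    have : Projective (f'.shortComplexKer).X₂ :=
      inferInstanceAs (Projective (ModuleCat.of R (ULift.{u} (Fin n) → R)))
    obtain ⟨e₁, rfl⟩ := Ext.contravariant_sequence_exact₃ hS (ModuleCat.of R A) e
      (Ext.eq_zero_of_projective _) (add_comm 1 i)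
    obtain ⟨m, hm⟩ := ih (LinearMap.ker f') e₁
    refine ⟨m, ?_⟩
    rw [← Ext.comp_smul]
    exact (congrArg (fun z ↦ hS.extClass.comp z (add_comm 1 i)) hm).trans (Ext.comp_zero _ _ _ _ _)

lemma ExtPowFinite.of_powTorsion (hA : PowTorsion g A) : ExtPowFinite I g A :=
  fun N _ _ _ _ i ↦ (powTorsion_ext hA i N).powFinite

variable {f : A →ₗ[R] B} {h : B →ₗ[R] C} (hex : Function.Exact f h) (hf : Function.Injective f)
  (hh : Function.Surjective h)

include hex hf hh

lemma ExtPowFinite.mid (hA : ExtPowFinite I g A) (hC : ExtPowFinite I g C) :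
    ExtPowFinite I g B := fun N _ _ _ hN i ↦
  .of_exact (ext_exact₂ (ModuleCat.of R N) (sesComplex_shortExact hex hf hh) i)
    (hA N hN i) (hC N hN i)

lemma ExtPowFinite.right (hA : ExtPowFinite I g A) (hB : ExtPowFinite I g B) :
    ExtPowFinite I g C := fun N _ _ _ hN i ↦
  .of_exact (ext_exact₃ (ModuleCat.of R N) (sesComplex_shortExact hex hf hh) i)
    (hB N hN i) (hA N hN (i + 1))

lemma ExtPowFinite.left (hB : ExtPowFinite I g B) (hC : ExtPowFinite I g C) :
    ExtPowFinite I g A := by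
  intro N _ _ _ hN i
  cases i with
  | zero =>
    refine .of_ker (extPostcomp (ModuleCat.of R N) (Ext.mk₀ (sesComplex hex).f) (add_zero 0))
      (fun b hb ↦ ⟨0, ?_⟩) (hB N hN 0)
    rw [pow_zero, one_smul]
    exact ext_zero_injective (ModuleCat.of R N) (sesComplex_shortExact hex hf hh)
      (hb.trans (map_zero _).symm)
  | succ i =>
    exact .of_exact (ext_exact₁ (ModuleCat.of R N) (sesComplex_shortExact hex hf hh) i)
      (hC N hN i) (hB N hN (i + 1))

end

section
variable [IsNoetherianRing R]

lemma ExtPowFinite.of_injective_mod (f : A →ₗ[R] B) (hf : Function.Injective f)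
    (hco : ∀ b, ∃ n : ℕ, g ^ n • b ∈ LinearMap.range f) :
    ExtPowFinite I g A ↔ ExtPowFinite I g B := by
  have hT : PowTorsion g (B ⧸ LinearMap.range f) := by
    intro x
    obtain ⟨b, rfl⟩ := Submodule.mkQ_surjective _ x
    obtain ⟨n, hn⟩ := hco b
    refine ⟨n, ?_⟩
    rw [← map_smul]
    exact (Submodule.Quotient.mk_eq_zero _).2 hn
  have hex := f.exact_map_mkQ_range
  exact ⟨fun h ↦ .mid hex hf (Submodule.mkQ_surjective _) h (.of_powTorsion hT),
    fun h ↦ .left hex hf (Submodule.mkQ_surjective _) h (.of_powTorsion hT)⟩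

lemma ExtPowFinite.of_surjective_mod (f : A →ₗ[R] B) (hf : Function.Surjective f)
    (hker : ∀ a, f a = 0 → ∃ n : ℕ, g ^ n • a = 0) :
    ExtPowFinite I g A ↔ ExtPowFinite I g B := by
  have hT : PowTorsion g (LinearMap.ker f) := by
    rintro ⟨a, ha⟩
    obtain ⟨n, hn⟩ := hker a ha
    exact ⟨n, Subtype.ext hn⟩
  have hex := LinearMap.exact_subtype_ker_map f
  exact ⟨fun h ↦ .right hex (Submodule.subtype_injective _) hf (.of_powTorsion hT) h,
    fun h ↦ .mid hex (Submodule.subtype_injective _) hf (.of_powTorsion hT) h⟩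

lemma ExtPowFinite.of_mod (f : A →ₗ[R] B) (hker : ∀ a, f a = 0 → ∃ n : ℕ, g ^ n • a = 0)
    (hco : ∀ b, ∃ n : ℕ, g ^ n • b ∈ LinearMap.range f) :
    ExtPowFinite I g A ↔ ExtPowFinite I g B := by
  refine (of_surjective_mod f.rangeRestrict f.surjective_rangeRestrict fun a ha ↦
    hker a (congrArg Subtype.val ha)).trans
    (of_injective_mod (LinearMap.range f).subtype (Submodule.subtype_injective _) ?_)
  simpa using hco

lemma ExtPowFinite.of_equiv (e : A ≃ₗ[R] B) (h : ExtPowFinite I g A) : ExtPowFinite I g B :=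
  (of_mod e.toLinearMap (fun a ha ↦ ⟨0, by simpa using ha⟩)
    (fun b ↦ ⟨0, e.symm (g ^ 0 • b), by simp⟩)).1 h

lemma ExtPowFinite.of_exact (f : A →ₗ[R] B) (h : B →ₗ[R] C) (hex : Function.Exact f h)
    (hker : ∀ a, f a = 0 → ∃ n : ℕ, g ^ n • a = 0)
    (hco : ∀ c, ∃ n : ℕ, g ^ n • c ∈ LinearMap.range h)
    (hA : ExtPowFinite I g A) (hC : ExtPowFinite I g C) : ExtPowFinite I g B := by
  have h1 : ExtPowFinite I g (LinearMap.range f) :=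
    (of_surjective_mod f.rangeRestrict f.surjective_rangeRestrict fun a ha ↦
      hker a (congrArg Subtype.val ha)).1 hA
  have h2 : ExtPowFinite I g (LinearMap.range h) :=
    (of_injective_mod (LinearMap.range h).subtype (Submodule.subtype_injective _)
      (by simpa using hco)).2 hC
  refine .mid (f := (LinearMap.range f).subtype) (h := h.rangeRestrict) ?_
    (Submodule.subtype_injective _) h.surjective_rangeRestrict h1 h2
  intro b
  rw [Submodule.coe_subtype, Subtype.range_coe]
  exact Iff.trans ⟨fun hb ↦ congrArg Subtype.val hb, fun hb ↦ Subtype.ext hb⟩ (hex b)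

end

lemma ext_eq_zero_of_bijective {N : Type u} [AddCommGroup N] [Module R N] {a : R}
    (ha : Function.Bijective (fun x : A ↦ a • x)) {k : ℕ} (hk : a ^ k ∈ Module.annihilator R N)
    {i : ℕ} (e : Ext (ModuleCat.of R N) (ModuleCat.of R A) i) : e = 0 := by
  have h1 : (a ^ k) • e = 0 := by
    have h0 : (a ^ k) • 𝟙 (ModuleCat.of R N) = 0 := by
      ext x
      exact Module.mem_annihilator.1 hk x
    have : (a ^ k) • e = (Ext.mk₀ ((a ^ k) • 𝟙 (ModuleCat.of R N))).comp e (zero_add i) := by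
      rw [Ext.mk₀_smul, Ext.smul_comp, Ext.mk₀_id_comp]
    rw [this, h0, Ext.mk₀_zero, Ext.zero_comp]
  have hb : ∀ n : ℕ, Function.Bijective (fun x : A ↦ a ^ n • x) := by
    intro n
    induction n with
    | zero => exact (by ext; simp : (fun x : A ↦ a ^ 0 • x) = id) ▸ Function.bijective_id
    | succ n ih =>
      have := ih.comp ha
      simpa [Function.comp_def, pow_succ, mul_smul] using this
  let l : A ≃ₗ[R] A := LinearEquiv.ofBijective (LinearMap.lsmul R A (a ^ k)) (hb k)
  have h2 : ((a ^ k) • e).comp (Ext.mk₀ (ModuleCat.ofHom l.symm.toLinearMap)) (add_zero i) = e := by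
    have h3 : ((a ^ k) • 𝟙 (ModuleCat.of R A)) ≫ ModuleCat.ofHom l.symm.toLinearMap = 𝟙 _ := by
      ext x
      exact l.symm_apply_apply x
    have : (a ^ k) • e = e.comp (Ext.mk₀ ((a ^ k) • 𝟙 (ModuleCat.of R A))) (add_zero i) := by
      rw [Ext.mk₀_smul, Ext.comp_smul, Ext.comp_mk₀_id]
    rw [this, Ext.comp_assoc_of_third_deg_zero, Ext.mk₀_comp_mk₀, h3, Ext.comp_mk₀_id]
  rw [← h2, h1, Ext.zero_comp]

lemma ExtPowFinite.of_bijective {a : R} (haI : a ∈ I)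
    (ha : Function.Bijective (fun x : A ↦ a • x)) : ExtPowFinite I g A := by
  rintro N _ _ _ ⟨k, hk⟩ i
  have : Subsingleton (Ext (ModuleCat.of R N) (ModuleCat.of R A) i) :=
    ⟨fun x y ↦ by
      rw [ext_eq_zero_of_bijective ha (hk (Ideal.pow_mem_pow haI k)) x,
        ext_eq_zero_of_bijective ha (hk (Ideal.pow_mem_pow haI k)) y]⟩
  exact PowTorsion.of_subsingleton.powFinite

lemma loc_eq_zero_of_bijective {a : R} (haI : a ∈ I)
    (ha : Function.Bijective (fun x : A ↦ a • x)) (j : ℕ) (x : loc I j (ModuleCat.of R A)) :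
    x = 0 := by
  obtain ⟨t, e, rfl⟩ := exists_toLoc x
  rw [ext_eq_zero_of_bijective ha (k := t) _ e, map_zero]
  rw [Ideal.annihilator_quotient]
  exact Ideal.pow_mem_pow haI t

end ExtPowFinite

section TorsionPart
variable {R : Type*} [CommRing R] (I : Ideal R) (X : Type*) [AddCommGroup X] [Module R X]

/-- The submodule of elements annihilated by a power of `I`. -/
def powTorsionPart : Submodule R X where
  carrier := {x | ∃ k : ℕ, ∀ a ∈ I ^ k, a • x = 0}
  zero_mem' := ⟨0, fun a _ ↦ smul_zero a⟩
  add_mem' := by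
    rintro x y ⟨k, hk⟩ ⟨l, hl⟩
    refine ⟨k + l, fun a ha ↦ ?_⟩
    rw [smul_add, hk a (Ideal.pow_le_pow_right (Nat.le_add_right k l) ha),
      hl a (Ideal.pow_le_pow_right (Nat.le_add_left l k) ha), add_zero]
  smul_mem' := by
    rintro r x ⟨k, hk⟩
    exact ⟨k, fun a ha ↦ by rw [smul_comm, hk a ha, smul_zero]⟩

variable {I X}

lemma powTorsionPart_powTorsionPart : powTorsionPart I (powTorsionPart I X) = ⊤ := by
  refine eq_top_iff.2 ?_
  rintro ⟨x, k, hk⟩ -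
  exact ⟨k, fun a ha ↦ Subtype.ext (hk a ha)⟩

lemma powTorsionPart_eq_top_of_surjective {Y : Type*} [AddCommGroup Y] [Module R Y]
    {f : X →ₗ[R] Y} (hf : Function.Surjective f) (h : powTorsionPart I X = ⊤) :
    powTorsionPart I Y = ⊤ := by
  refine eq_top_iff.2 fun y _ ↦ ?_
  obtain ⟨x, rfl⟩ := hf y
  obtain ⟨k, hk⟩ : x ∈ powTorsionPart I X := h ▸ trivial
  exact ⟨k, fun a ha ↦ by rw [← map_smul, hk a ha, map_zero]⟩

lemma exists_pow_smul_eq_zero_of_fg {N : Type*} [AddCommGroup N] [Module R N] [Module.Finite R N]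
    (f : N →ₗ[R] X) (h : ∀ x, f x ∈ powTorsionPart I X) :
    ∃ k : ℕ, ∀ a ∈ I ^ k, ∀ x, a • f x = 0 := by
  have key : ∀ T : Submodule R N, T.FG → ∃ k : ℕ, ∀ a ∈ I ^ k, ∀ x ∈ T, a • f x = 0 := by
    intro T hT
    induction T, hT using Submodule.fg_induction with
    | singleton x =>
      obtain ⟨n, hn⟩ := h x
      refine ⟨n, fun a ha y hy ↦ ?_⟩
      obtain ⟨r, rfl⟩ := Submodule.mem_span_singleton.1 hy
      rw [map_smul, smul_comm, hn a ha, smul_zero]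
    | sup T₁ T₂ _ _ h₁ h₂ =>
      obtain ⟨n, hn⟩ := h₁
      obtain ⟨m, hm⟩ := h₂
      refine ⟨n + m, fun a ha y hy ↦ ?_⟩
      obtain ⟨y₁, h₁, y₂, h₂, rfl⟩ := Submodule.mem_sup.1 hy
      rw [map_add, smul_add, hn a (Ideal.pow_le_pow_right (Nat.le_add_right n m) ha) _ h₁,
        hm a (Ideal.pow_le_pow_right (Nat.le_add_left m n) ha) _ h₂, add_zero]
  obtain ⟨k, hk⟩ := key ⊤ Module.Finite.fg_top
  exact ⟨k, fun a ha x ↦ hk a ha x trivial⟩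

lemma baer_powTorsionPart [IsNoetherianRing R] (hX : Module.Baer R X) :
    Module.Baer R (powTorsionPart I X) := by
  intro J φ
  let ψ := (powTorsionPart I X).subtype ∘ₗ φ
  obtain ⟨t, ht⟩ := exists_pow_smul_eq_zero_of_fg (I := I) ψ fun x ↦ (φ x).2
  obtain ⟨k, hk⟩ := Ideal.exists_pow_inf_eq_pow_smul I J
  have hvan : ∀ x (hx : x ∈ J), x ∈ I ^ (k + t) → ψ ⟨x, hx⟩ = 0 := by
    intro x hx hxI
    have h1 : x ∈ I ^ t • (I ^ k • (⊤ : Submodule R R) ⊓ J) := by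
      have := hk (k + t) (Nat.le_add_right k t)
      rw [Nat.add_sub_cancel_left] at this
      rw [← this]
      exact ⟨by simpa using hxI, hx⟩
    have h2 : I ^ t • (I ^ k • (⊤ : Submodule R R) ⊓ J) ≤ (LinearMap.ker ψ).map J.subtype := by
      refine Submodule.smul_le.2 fun a ha y hy ↦ ⟨a • ⟨y, hy.2⟩, ?_, rfl⟩
      exact (map_smul ψ a _).trans (ht a ha _)
    obtain ⟨y, hy, rfl⟩ := h2 h1
    exact hy
  let p : R →ₗ.[R] X := ⟨J, ψ⟩
  let q : R →ₗ.[R] X := ⟨I ^ (k + t), 0⟩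
  have hpq : ∀ (x : p.domain) (y : q.domain), (x : R) = y → p x = q y := by
    rintro ⟨x, hx⟩ ⟨y, hy⟩ rfl
    exact hvan _ hx hy
  obtain ⟨χ, hχ⟩ := hX (p.sup q hpq).domain (p.sup q hpq).toFun
  have hχJ : ∀ x (hx : x ∈ J), χ x = ψ ⟨x, hx⟩ := by
    intro x hx
    rw [hχ x ((le_sup_left : J ≤ J ⊔ I ^ (k + t)) hx)]
    refine (LinearPMap.sup_apply hpq ⟨x, hx⟩ 0 _ ?_).trans ?_
    · simp
    · exact (congrArg (p ⟨x, hx⟩ + ·) q.map_zero).trans (add_zero _)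
  have hχI : ∀ x ∈ I ^ (k + t), χ x = 0 := by
    intro x hx
    rw [hχ x ((le_sup_right : I ^ (k + t) ≤ J ⊔ I ^ (k + t)) hx)]
    refine (LinearPMap.sup_apply hpq 0 ⟨x, hx⟩ _ ?_).trans ?_
    · simp
    · exact (congrArg (· + q ⟨x, hx⟩) p.map_zero).trans (zero_add _)
  refine ⟨LinearMap.toSpanSingleton R _ ⟨χ 1, k + t, fun a ha ↦ ?_⟩, fun x hx ↦ ?_⟩
  · rw [← map_smul, smul_eq_mul, mul_one, hχI a ha]
  · apply Subtype.ext
    rw [LinearMap.toSpanSingleton_apply]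
    change x • χ 1 = ψ ⟨x, hx⟩
    rw [← map_smul, smul_eq_mul, mul_one, hχJ x hx]

end TorsionPart

section LocalCohomology
open Abelian
variable {R : Type u} [CommRing R] (I : Ideal R)

/-- Evaluation at one, on the degree zero `Ext` modules out of quotients of `R`. -/
def extEval (J : Ideal R) (X : ModuleCat.{u} R) : Ext (ModuleCat.of R (R ⧸ J)) X 0 →ₗ[R] X :=
  LinearMap.applyₗ (Submodule.Quotient.mk 1) ∘ₗ
    (ModuleCat.homLinearEquiv (S := R)).toLinearMap ∘ₗ (Ext.linearEquiv₀ (R := R)).toLinearMap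

lemma extEval_mk₀ {J : Ideal R} {X : ModuleCat.{u} R} (f : ModuleCat.of R (R ⧸ J) ⟶ X) :
    extEval J X (Ext.mk₀ f) = f.hom (Submodule.Quotient.mk 1) := by
  have : Ext.linearEquiv₀ (R := R) (Ext.mk₀ f) = f :=
    Ext.linearEquiv₀.apply_symm_apply (R := R) f
  exact congrArg (fun h : ModuleCat.of R (R ⧸ J) ⟶ X ↦ h.hom (Submodule.Quotient.mk 1)) this

lemma exists_mk₀ {X Y : ModuleCat.{u} R} (e : Ext X Y 0) : ∃ f, Ext.mk₀ f = e :=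
  ⟨_, Ext.mk₀_linearEquiv₀_apply (R := R) e⟩

lemma extEval_injective (J : Ideal R) (X : ModuleCat.{u} R) :
    Function.Injective (extEval J X) := by
  rw [← LinearMap.ker_eq_bot, LinearMap.ker_eq_bot']
  intro e he
  obtain ⟨f, rfl⟩ := exists_mk₀ e
  rw [extEval_mk₀] at he
  have : f = 0 := by
    refine ModuleCat.hom_ext (LinearMap.ext fun y ↦ ?_)
    obtain ⟨x, rfl⟩ := Submodule.Quotient.mk_surjective (p := J) y
    have h2 : Submodule.Quotient.mk x = x • (Submodule.Quotient.mk 1 : R ⧸ J) := by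
      rw [← Submodule.Quotient.mk_smul, smul_eq_mul, mul_one]
    refine (congrArg f.hom h2).trans ?_
    exact (map_smul f.hom x _).trans ((congrArg (x • ·) he).trans (smul_zero x))
  rw [this, Ext.mk₀_zero]

/-- The inclusion of degree zero local cohomology. -/
def locEval (X : ModuleCat.{u} R) : loc I 0 X →ₗ[R] X :=
  Module.DirectLimit.lift R ℕ _ (powExtMap I 0 X) (fun t ↦ extEval (I ^ t) X) (by
    intro t s h e
    obtain ⟨f, rfl⟩ := exists_mk₀ e
    rw [extPrecomp_apply, Ext.mk₀_comp_mk₀, extEval_mk₀, extEval_mk₀]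
    rfl)

lemma locEval_toLoc {X : ModuleCat.{u} R} {t : ℕ} (e : Ext (ModuleCat.of R (R ⧸ I ^ t)) X 0) :
    locEval I X (toLoc I 0 X t e) = extEval (I ^ t) X e :=
  Module.DirectLimit.lift_of _ _ _

lemma locEval_injective (X : ModuleCat.{u} R) : Function.Injective (locEval I X) := by
  rw [← LinearMap.ker_eq_bot, LinearMap.ker_eq_bot']
  intro x hx
  obtain ⟨t, e, rfl⟩ := exists_toLoc x
  rw [locEval_toLoc] at hx
  rw [extEval_injective _ _ (hx.trans (map_zero _).symm), map_zero]

lemma mem_range_locEval {X : ModuleCat.{u} R} {x : X} (hx : x ∈ powTorsionPart I X) :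
    ∃ e, locEval I X e = x := by
  obtain ⟨t, ht⟩ := hx
  let f : ModuleCat.of R (R ⧸ I ^ t) ⟶ X := ModuleCat.ofHom
    (Submodule.liftQ (I ^ t) (LinearMap.toSpanSingleton R X x) fun a ha ↦ ht a ha)
  refine ⟨toLoc I 0 X t (Ext.mk₀ f), ?_⟩
  rw [locEval_toLoc, extEval_mk₀]
  exact one_smul R x

lemma locEval_locHom {X Y : ModuleCat.{u} R} (f : X ⟶ Y) (x : loc I 0 X) :
    locEval I Y (locHom I f 0 x) = f.hom (locEval I X x) := by
  obtain ⟨t, e, rfl⟩ := exists_toLoc x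
  obtain ⟨φ, rfl⟩ := exists_mk₀ e
  rw [locMap_toLoc, locEval_toLoc, locEval_toLoc, Ext.mk₀_comp_mk₀, extEval_mk₀, extEval_mk₀]
  rfl

lemma powTorsionPart_loc (j : ℕ) (X : ModuleCat.{u} R) : powTorsionPart I (loc I j X) = ⊤ := by
  refine eq_top_iff.2 fun x _ ↦ ?_
  obtain ⟨t, e, rfl⟩ := exists_toLoc x
  refine ⟨t, fun a ha ↦ ?_⟩
  have h0 : a • 𝟙 (ModuleCat.of R (R ⧸ I ^ t)) = 0 := by
    refine ModuleCat.hom_ext (LinearMap.ext fun y ↦ ?_)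
    obtain ⟨x, rfl⟩ := Submodule.Quotient.mk_surjective (p := I ^ t) y
    change a • (Submodule.Quotient.mk x : R ⧸ I ^ t) = 0
    rw [← Submodule.Quotient.mk_smul, Submodule.Quotient.mk_eq_zero]
    exact Ideal.mul_mem_right x _ ha
  have : a • e = (Ext.mk₀ (a • 𝟙 (ModuleCat.of R (R ⧸ I ^ t)))).comp e (zero_add j) := by
    rw [Ext.mk₀_smul, Ext.smul_comp, Ext.mk₀_id_comp]
  rw [← map_smul, this, h0, Ext.mk₀_zero, Ext.zero_comp, map_zero]

lemma locEval_mem (X : ModuleCat.{u} R) (x : loc I 0 X) : locEval I X x ∈ powTorsionPart I X := by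
  obtain ⟨k, hk⟩ : x ∈ powTorsionPart I (loc I 0 X) := powTorsionPart_loc I 0 X ▸ trivial
  exact ⟨k, fun a ha ↦ by rw [← map_smul, hk a ha, map_zero]⟩

lemma loc_eq_zero_of_injective (X : ModuleCat.{u} R) [Injective X] (j : ℕ) (x : loc I (j + 1) X) :
    x = 0 := by
  obtain ⟨t, e, rfl⟩ := exists_toLoc x
  rw [Ext.eq_zero_of_injective e, map_zero]

lemma exists_torsion_embedding [IsNoetherianRing R] (X : Type u) [AddCommGroup X] [Module R X]
    (hX : powTorsionPart I X = ⊤) : ∃ (G : Type u) (_ : AddCommGroup G) (_ : Module R G)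
      (f : X →ₗ[R] G), Function.Injective f ∧ Injective (ModuleCat.of R G) ∧
      powTorsionPart I G = ⊤ := by
  let E := Injective.under (ModuleCat.of R X)
  let ι : X →ₗ[R] E := (Injective.ι (ModuleCat.of R X)).hom
  have hι : Function.Injective ι := (ModuleCat.mono_iff_injective _).1 inferInstance
  have hE' : Injective (ModuleCat.of R E) :=
    inferInstanceAs (Injective (Injective.under (ModuleCat.of R X)))
  have hE : Module.Injective R E := Module.injective_module_of_injective_object R E
  have hG := (baer_powTorsionPart (I := I) (Module.Baer.of_injective hE)).injective
  refine ⟨powTorsionPart I E, inferInstance, inferInstance,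
    ι.codRestrict (powTorsionPart I E) fun x ↦ ?_, fun x y hxy ↦ hι (congrArg Subtype.val hxy),
    Module.injective_object_of_injective_module R _, powTorsionPart_powTorsionPart⟩
  obtain ⟨k, hk⟩ : x ∈ powTorsionPart I X := hX ▸ trivial
  exact ⟨k, fun a ha ↦ by rw [← map_smul, hk a ha, map_zero]⟩

lemma loc_eq_zero_of_torsion [IsNoetherianRing R] (j : ℕ) : ∀ (X : Type u) [AddCommGroup X]
    [Module R X], powTorsionPart I X = ⊤ → ∀ x : loc I (j + 1) (ModuleCat.of R X), x = 0 := by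
  induction j with
  | zero =>
    intro X _ _ hX x
    obtain ⟨G, _, _, f, hf, hG, hGt⟩ := exists_torsion_embedding I X hX
    have hS := sesComplex_shortExact f.exact_map_mkQ_range hf (Submodule.mkQ_surjective _)
    obtain ⟨y, rfl⟩ := (loc_exact₁ I hS 0 x).1 (loc_eq_zero_of_injective I (ModuleCat.of R G) 0 _)
    refine (loc_exact₃ I hS 0 y).2 ?_
    obtain ⟨z, hz⟩ := Submodule.mkQ_surjective _
      (locEval I (ModuleCat.of R (G ⧸ LinearMap.range f)) y)
    obtain ⟨w, hw⟩ := mem_range_locEval I (X := ModuleCat.of R G) (x := z) (hGt ▸ trivial)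
    refine ⟨w, locEval_injective I _ ?_⟩
    refine (locEval_locHom I _ w).trans ?_
    exact (congrArg (LinearMap.range f).mkQ hw).trans hz
  | succ j ih =>
    intro X _ _ hX x
    obtain ⟨G, _, _, f, hf, hG, hGt⟩ := exists_torsion_embedding I X hX
    have hS := sesComplex_shortExact f.exact_map_mkQ_range hf (Submodule.mkQ_surjective _)
    obtain ⟨y, rfl⟩ := (loc_exact₁ I hS (j + 1) x).1
      (loc_eq_zero_of_injective I (ModuleCat.of R G) (j + 1) _)
    have : y = 0 := ih (G ⧸ LinearMap.range f)
      (powTorsionPart_eq_top_of_surjective (Submodule.mkQ_surjective _) hGt) y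
    rw [this, map_zero]

lemma powTorsion_loc [IsNoetherianRing R] {g : R} {X : Type u} [AddCommGroup X] [Module R X]
    (hX : PowTorsion g X) (j : ℕ) : PowTorsion g (loc I j (ModuleCat.of R X)) := by
  intro x
  obtain ⟨t, e, rfl⟩ := exists_toLoc x
  obtain ⟨n, hn⟩ := powTorsion_ext hX j (R ⧸ I ^ t) e
  exact ⟨n, by rw [← map_smul, hn, map_zero]⟩

/-- Up to `g`-power torsion, every element is annihilated by a power of `I`. -/
def ModTorsion (I : Ideal R) (g : R) (X : Type u) [AddCommGroup X] [Module R X] : Prop :=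
  ∀ x : X, ∃ k n : ℕ, ∀ a ∈ I ^ k, g ^ n • a • x = 0

lemma ModTorsion.smul_mem {g : R} {X : Type u} [AddCommGroup X] [Module R X]
    (hX : ModTorsion I g X) (x : X) : ∃ n : ℕ, g ^ n • x ∈ powTorsionPart I X := by
  obtain ⟨k, n, h⟩ := hX x
  exact ⟨n, k, fun a ha ↦ by rw [smul_comm, h a ha]⟩

lemma ModTorsion.powTorsion_loc [IsNoetherianRing R] {g : R} {X : Type u} [AddCommGroup X]
    [Module R X] (hX : ModTorsion I g X) (j : ℕ) :
    PowTorsion g (loc I (j + 1) (ModuleCat.of R X)) := by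
  have hS := sesComplex_shortExact (LinearMap.exact_subtype_mkQ (powTorsionPart I X))
    (Submodule.subtype_injective _) (Submodule.mkQ_surjective _)
  have h3 : PowTorsion g (X ⧸ powTorsionPart I X) := by
    intro x
    obtain ⟨x, rfl⟩ := Submodule.mkQ_surjective _ x
    obtain ⟨n, hn⟩ := hX.smul_mem I x
    refine ⟨n, ?_⟩
    rw [← map_smul]
    exact (Submodule.Quotient.mk_eq_zero _).2 hn
  refine PowTorsion.of_exact (loc_exact₂ I hS (j + 1)) (fun x ↦ ⟨0, ?_⟩)
    (_root_.powTorsion_loc I h3 (j + 1))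
  rw [pow_zero, one_smul]
  exact loc_eq_zero_of_torsion I j _ powTorsionPart_powTorsionPart x

lemma ModTorsion.extPowFinite_loc_zero [IsNoetherianRing R] {g : R} {X : Type u} [AddCommGroup X]
    [Module R X] (hX : ModTorsion I g X) :
    ExtPowFinite I g (loc I 0 (ModuleCat.of R X)) ↔ ExtPowFinite I g X := by
  refine ExtPowFinite.of_injective_mod (A := loc I 0 (ModuleCat.of R X))
    (locEval I (ModuleCat.of R X)) (locEval_injective I _) fun x ↦ ?_
  obtain ⟨n, hn⟩ := hX.smul_mem I x
  exact ⟨n, mem_range_locEval I hn⟩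

lemma loc_zero_injective {S : ShortComplex (ModuleCat.{u} R)} (hS : S.ShortExact) :
    Function.Injective (locHom I S.f 0) := by
  have hf := (ModuleCat.mono_iff_injective _).1 hS.mono_f
  intro x y hxy
  apply locEval_injective I
  apply hf
  exact (locEval_locHom I S.f x).symm.trans ((congrArg (locEval I S.X₂) hxy).trans
    (locEval_locHom I S.f y))

end LocalCohomology

section PrincipalCriterion
variable {R : Type u} [CommRing R] {I : Ideal R} {g : R}

section
variable {X : Type u} [AddCommGroup X] [Module R X] {f : R}

/-- The localization of a module at the powers of an element. -/
abbrev awayModule (f : R) (X : Type u) [AddCommGroup X] [Module R X] : Type u :=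
  LocalizedModule (Submonoid.powers f) X

/-- The localization map of a module at the powers of an element. -/
abbrev toAway (f : R) (X : Type u) [AddCommGroup X] [Module R X] : X →ₗ[R] awayModule f X :=
  LocalizedModule.mkLinearMap (Submonoid.powers f) X

lemma away_smul_bijective : Function.Bijective (fun z : awayModule f X ↦ f • z) :=
  (Module.End.isUnit_iff _).1
    (IsLocalizedModule.map_units (toAway f X) ⟨f, Submonoid.mem_powers f⟩)

lemma away_pow_smul_injective (m : ℕ) {z w : awayModule f X} (h : f ^ m • z = f ^ m • w) :
    z = w := by
  induction m with
  | zero => simpa using h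
  | succ m ih =>
    rw [pow_succ', mul_smul, mul_smul] at h
    exact ih (away_smul_bijective.1 h)

lemma toAway_eq_zero {x : X} (h : toAway f X x = 0) : ∃ m : ℕ, f ^ m • x = 0 := by
  obtain ⟨⟨_, m, rfl⟩, hm⟩ := (IsLocalizedModule.eq_zero_iff (Submonoid.powers f) _).1 h
  exact ⟨m, hm⟩

lemma exists_pow_smul_eq_toAway (z : awayModule f X) :
    ∃ (m : ℕ) (x : X), f ^ m • z = toAway f X x := by
  obtain ⟨⟨x, ⟨_, m, rfl⟩⟩, hm⟩ := IsLocalizedModule.surj (Submonoid.powers f) (toAway f X) z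
  exact ⟨m, x, hm⟩

lemma exists_smul_mem_span_pow_smul
    (hc : ∀ x : X, ∃ k n : ℕ, ∀ a ∈ I ^ k, g ^ n • a • x ∈ Submodule.span R {f • x})
    (x : X) (m : ℕ) :
    ∃ k n : ℕ, ∀ a ∈ I ^ k, g ^ n • a • x ∈ Submodule.span R {f ^ m • x} := by
  obtain ⟨k₁, n₁, h₁⟩ := hc x
  induction m with
  | zero =>
    refine ⟨0, 0, fun a _ ↦ ?_⟩
    simpa using Submodule.smul_mem _ a (Submodule.mem_span_singleton_self x)
  | succ m ih =>
    obtain ⟨k, n, h⟩ := ih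
    refine ⟨k + k₁, n + n₁, fun a ha ↦ ?_⟩
    rw [pow_add] at ha
    induction ha using Submodule.mul_induction_on' with
    | mem_mul_mem a ha b hb =>
      obtain ⟨r, hr⟩ := Submodule.mem_span_singleton.1 (h a ha)
      obtain ⟨s, hs⟩ := Submodule.mem_span_singleton.1 (h₁ b hb)
      refine Submodule.mem_span_singleton.2 ⟨r * s, ?_⟩
      calc (r * s) • f ^ (m + 1) • x = (r * f ^ m) • s • f • x := by
            simp only [smul_smul]; ring_nf
        _ = (g ^ n₁ * b) • r • f ^ m • x := by rw [hs]; simp only [smul_smul]; ring_nf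
        _ = _ := by rw [hr]; simp only [smul_smul]; ring_nf
    | add a _ b _ ha hb =>
      rw [add_smul, smul_add]
      exact add_mem ha hb

variable (X) in
lemma modTorsion_ker_toAway
    (hc : ∀ x : X, ∃ k n : ℕ, ∀ a ∈ I ^ k, g ^ n • a • x ∈ Submodule.span R {f • x}) :
    ModTorsion I g (LinearMap.ker (toAway f X)) := by
  rintro ⟨x, hx⟩
  obtain ⟨m, hm⟩ := toAway_eq_zero hx
  obtain ⟨k, n, h⟩ := exists_smul_mem_span_pow_smul hc x m
  refine ⟨k, n, fun a ha ↦ Subtype.ext ?_⟩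
  simpa [hm] using h a ha

variable (X) in
lemma modTorsion_coker_toAway
    (hc : ∀ x : X, ∃ k n : ℕ, ∀ a ∈ I ^ k, g ^ n • a • x ∈ Submodule.span R {f • x}) :
    ModTorsion I g (awayModule f X ⧸ LinearMap.range (toAway f X)) := by
  intro z
  obtain ⟨z, rfl⟩ := Submodule.mkQ_surjective _ z
  obtain ⟨m, x, hx⟩ := exists_pow_smul_eq_toAway z
  obtain ⟨k, n, h⟩ := exists_smul_mem_span_pow_smul hc x m
  refine ⟨k, n, fun a ha ↦ ?_⟩
  rw [← map_smul, ← map_smul]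
  refine (Submodule.Quotient.mk_eq_zero _).2 ?_
  obtain ⟨r, hr⟩ := Submodule.mem_span_singleton.1 (h a ha)
  refine ⟨r • x, away_pow_smul_injective (f := f) m ?_⟩
  rw [smul_comm (f ^ m) (g ^ n), smul_comm (f ^ m) a, hx, ← map_smul, ← map_smul, ← map_smul, ← hr,
    smul_comm]

end

section
variable {A B C : Type u} [AddCommGroup A] [Module R A] [AddCommGroup B] [Module R B]
    [AddCommGroup C] [Module R C] {f : A →ₗ[R] B} {h : B →ₗ[R] C} (hex : Function.Exact f h)
    (hf : Function.Injective f) (hh : Function.Surjective h)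
    (hB : ∀ j (x : loc I j (ModuleCat.of R B)), x = 0)
include hex hf hh hB

lemma loc_zero_eq_zero (x : loc I 0 (ModuleCat.of R A)) : x = 0 :=
  loc_zero_injective I (sesComplex_shortExact hex hf hh) ((hB 0 _).trans (map_zero _).symm)

lemma nonempty_loc_shift (j : ℕ) :
    Nonempty (loc I j (ModuleCat.of R C) ≃ₗ[R] loc I (j + 1) (ModuleCat.of R A)) := by
  have hS := sesComplex_shortExact hex hf hh
  refine ⟨LinearEquiv.ofBijective (locδ I hS j) ⟨?_, fun x ↦ (loc_exact₁ I hS j x).1 (hB _ _)⟩⟩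
  rw [← LinearMap.ker_eq_bot, LinearMap.ker_eq_bot']
  intro x hx
  obtain ⟨y, rfl⟩ := (loc_exact₃ I hS j x).1 hx
  exact (congrArg _ (hB j y)).trans (map_zero _)

end

lemma exists_pow_mul_mem_span_pair {x y : R}
    (hI : ∃ k n : ℕ, ∀ a ∈ I ^ k, g ^ n * a ∈ Ideal.span {x, y}) (m : ℕ) :
    ∃ k n : ℕ, ∀ a ∈ I ^ k, g ^ n * a ∈ Ideal.span {x ^ m, y} := by
  obtain ⟨k₁, n₁, h₁⟩ := hI
  induction m with
  | zero => exact ⟨0, 0, fun a _ ↦ Ideal.mem_span_pair.2 ⟨g ^ 0 * a, 0, by simp⟩⟩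
  | succ m ih =>
    obtain ⟨k, n, h⟩ := ih
    refine ⟨k + k₁, n + n₁, fun a ha ↦ ?_⟩
    rw [pow_add] at ha
    induction ha using Submodule.mul_induction_on' with
    | mem_mul_mem a ha b hb =>
      obtain ⟨r, s, hrs⟩ := Ideal.mem_span_pair.1 (h a ha)
      obtain ⟨r', s', hrs'⟩ := Ideal.mem_span_pair.1 (h₁ b hb)
      refine Ideal.mem_span_pair.2 ⟨r * r', s * (g ^ n₁ * b) + r * x ^ m * s', ?_⟩
      calc _ = (r * x ^ m) * (r' * x + s' * y) + s * y * (g ^ n₁ * b) := by ring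
        _ = _ := by rw [hrs', ← add_mul, hrs]; ring
    | add a _ b _ ha hb =>
      rw [mul_add]
      exact add_mem ha hb

variable [IsNoetherianRing R]

theorem extPowFinite_loc_of_principal {X : Type u} [AddCommGroup X] [Module R X] {f : R}
    (hf : f ∈ I)
    (hc : ∀ x : X, ∃ k n : ℕ, ∀ a ∈ I ^ k, g ^ n • a • x ∈ Submodule.span R {f • x})
    (hX : ExtPowFinite I g X) (h0 : ExtPowFinite I g (loc I 0 (ModuleCat.of R X))) :
    ExtPowFinite I g (loc I 1 (ModuleCat.of R X)) ∧
      ∀ j, PowTorsion g (loc I (j + 2) (ModuleCat.of R X)) := by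
  let φ := toAway f X
  have hK := modTorsion_ker_toAway X hc
  have hZ := modTorsion_coker_toAway X hc
  have hL : ∀ j (x : loc I j (ModuleCat.of R (awayModule f X))), x = 0 :=
    loc_eq_zero_of_bijective hf away_smul_bijective
  have ex1 : Function.Exact (LinearMap.ker φ).subtype φ.rangeRestrict := by
    intro x
    rw [Submodule.coe_subtype, Subtype.range_coe]
    exact ⟨fun hb ↦ congrArg Subtype.val hb, fun hb ↦ Subtype.ext hb⟩
  have ex2 := LinearMap.exact_subtype_mkQ (LinearMap.range φ)
  have s1 := sesComplex_shortExact ex1 (Submodule.subtype_injective _) φ.surjective_rangeRestrict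
  have hXt0 : ∀ x : loc I 0 (ModuleCat.of R (LinearMap.range φ)), x = 0 :=
    loc_zero_eq_zero ex2 (Submodule.subtype_injective _) (Submodule.mkQ_surjective _) hL
  have shift := fun j ↦ nonempty_loc_shift ex2 (Submodule.subtype_injective _)
    (Submodule.mkQ_surjective _) hL j
  have hT : ∀ j, PowTorsion g (loc I (j + 2) (ModuleCat.of R (LinearMap.range φ))) := fun j ↦
    (hZ.powTorsion_loc I j).of_equiv (shift (j + 1)).some
  refine ⟨?_, fun j ↦ .of_exact (loc_exact₂ I s1 (j + 2)) (hK.powTorsion_loc I (j + 1)) (hT j)⟩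
  have hK0 : ExtPowFinite I g (loc I 0 (ModuleCat.of R (LinearMap.ker φ))) := by
    refine (ExtPowFinite.of_mod (A := loc I 0 (ModuleCat.of R (LinearMap.ker φ)))
      (B := loc I 0 (ModuleCat.of R X)) (locHom I (sesComplex ex1).f 0) (fun x hx ↦ ⟨0, ?_⟩)
      fun x ↦ ⟨0, ?_⟩).2 h0
    · rw [pow_zero, one_smul]
      exact loc_zero_injective I s1 (hx.trans (map_zero _).symm)
    · rw [pow_zero, one_smul]
      exact (loc_exact₂ I s1 0 x).1 (hXt0 _)
  have hK' := (hK.extPowFinite_loc_zero I).1 hK0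
  have hXt : ExtPowFinite I g (LinearMap.range φ) :=
    .right ex1 (Submodule.subtype_injective _) φ.surjective_rangeRestrict hK' hX
  have hZ' : ExtPowFinite I g (awayModule f X ⧸ LinearMap.range φ) :=
    .right ex2 (Submodule.subtype_injective _) (Submodule.mkQ_surjective _) hXt
      (.of_bijective hf away_smul_bijective)
  have hXt1 : ExtPowFinite I g (loc I 1 (ModuleCat.of R (LinearMap.range φ))) :=
    .of_equiv (shift 0).some ((hZ.extPowFinite_loc_zero I).2 hZ')
  refine (ExtPowFinite.of_mod (A := loc I 1 (ModuleCat.of R X))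
    (B := loc I 1 (ModuleCat.of R (LinearMap.range φ))) (locHom I (sesComplex ex1).g 1)
    (fun x hx ↦ ?_) fun x ↦ ?_).2 hXt1
  · obtain ⟨y, rfl⟩ := (loc_exact₂ I s1 1 x).1 hx
    obtain ⟨n, hn⟩ := hK.powTorsion_loc I 0 y
    exact ⟨n, by rw [← map_smul]; exact (congrArg _ hn).trans (map_zero _)⟩
  · obtain ⟨n, hn⟩ := hK.powTorsion_loc I 1 (locδ I s1 1 x)
    exact ⟨n, (loc_exact₃ I s1 1 _).1 ((map_smul _ _ _).trans hn)⟩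

lemma ExtPowFinite.loc_zero_of_finite {M : Type u} [AddCommGroup M] [Module R M]
    [Module.Finite R M] : ExtPowFinite I g (loc I 0 (ModuleCat.of R M)) := by
  have : Module.Finite R (loc I 0 (ModuleCat.of R M)) :=
    Module.Finite.of_injective _ (locEval_injective I (ModuleCat.of R M))
  exact .of_finite

theorem extPowFinite_loc_of_finite {M : Type u} [AddCommGroup M] [Module R M]
    [Module.Finite R M] {f : R} (hf : f ∈ I)
    (hc : ∀ x : M, ∃ k n : ℕ, ∀ a ∈ I ^ k, g ^ n • a • x ∈ Submodule.span R {f • x}) :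
    ExtPowFinite I g (loc I 1 (ModuleCat.of R M)) ∧
      ∀ j, PowTorsion g (loc I (j + 2) (ModuleCat.of R M)) :=
  extPowFinite_loc_of_principal hf hc .of_finite .loc_zero_of_finite

theorem extPowFinite_loc_of_principal_of_finite {M : Type u} [AddCommGroup M] [Module R M]
    [Module.Finite R M] {f : R} (hf : f ∈ I) (hI : ∃ k n : ℕ, ∀ a ∈ I ^ k, f ∣ g ^ n * a) (j : ℕ) :
    ExtPowFinite I g (loc I j (ModuleCat.of R M)) := by
  have := extPowFinite_loc_of_finite (M := M) (g := g) hf fun x ↦ by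
    obtain ⟨k, n, h⟩ := hI
    refine ⟨k, n, fun a ha ↦ ?_⟩
    obtain ⟨c, hc⟩ := h a ha
    rw [smul_smul, hc, mul_comm, mul_smul]
    exact Submodule.smul_mem _ _ (Submodule.mem_span_singleton_self _)
  match j with
  | 0 => exact .loc_zero_of_finite
  | 1 => exact this.1
  | j + 2 => exact .of_powTorsion (this.2 j)

theorem loc_of_regular_pair {F : Type u} [AddCommGroup F] [Module R F] [Module.Finite R F]
    {x y : R} (hx : x ∈ I) (hy : y ∈ I) (hxF : Function.Injective (fun v : F ↦ x • v))
    (hxy : ∀ v w : F, y • v = x • w → ∃ (n : ℕ) (v' : F), g ^ n • v = x • v')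
    (hI : ∃ k n : ℕ, ∀ a ∈ I ^ k, g ^ n * a ∈ Ideal.span {x, y}) :
    (∀ v : loc I 0 (ModuleCat.of R F), v = 0) ∧ PowTorsion g (loc I 1 (ModuleCat.of R F)) ∧
      ExtPowFinite I g (loc I 2 (ModuleCat.of R F)) ∧
      ∀ j, PowTorsion g (loc I (j + 3) (ModuleCat.of R F)) := by
  let φ := toAway x F
  have hpow : ∀ (m : ℕ) (v : F), x ^ m • v = 0 → v = 0 := by
    intro m
    induction m with
    | zero => intro v hv; simpa using hv
    | succ m ih =>
      intro v hv
      rw [pow_succ', mul_smul] at hv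
      exact ih v (hxF (by simpa using hv))
  have hφ : Function.Injective φ := by
    rw [← LinearMap.ker_eq_bot, LinearMap.ker_eq_bot']
    intro v hv
    obtain ⟨m, hm⟩ := toAway_eq_zero hv
    exact hpow m v hm
  have hL : ∀ j (v : loc I j (ModuleCat.of R (awayModule x F))), v = 0 :=
    loc_eq_zero_of_bijective hx away_smul_bijective
  have ex := φ.exact_map_mkQ_range
  let Y := awayModule x F ⧸ LinearMap.range φ
  have shift := fun j ↦ nonempty_loc_shift ex hφ (Submodule.mkQ_surjective _) hL j
  have hY : ExtPowFinite I g Y := .right ex hφ (Submodule.mkQ_surjective _) .of_finite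
    (.of_bijective hx away_smul_bijective)
  have hdiv : ∀ (m : ℕ) (w v : F), y • w = x ^ m • v →
      ∃ (n : ℕ) (v' : F), g ^ n • w = x ^ m • v' := by
    intro m
    induction m with
    | zero => intro w v _; exact ⟨0, w, by simp⟩
    | succ m ih =>
      intro w v h
      obtain ⟨n, w', hw'⟩ := hxy w (x ^ m • v) (by rw [h, pow_succ', mul_smul])
      obtain ⟨l, v', hv'⟩ := ih w' (g ^ n • v) (by
        apply hxF
        change x • y • w' = x • x ^ m • g ^ n • v
        rw [smul_comm x y, ← hw', smul_comm y, h, pow_succ', mul_smul, smul_comm (g ^ n) x,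
          smul_comm (g ^ n)])
      refine ⟨l + n, v', ?_⟩
      rw [pow_add, mul_smul, hw', smul_comm, hv', pow_succ', mul_smul]
  have hker : ∀ z : Y, y • z = 0 → ∃ n : ℕ, g ^ n • z = 0 := by
    intro z hz
    obtain ⟨z, rfl⟩ := Submodule.mkQ_surjective _ z
    obtain ⟨m, w, hw⟩ := exists_pow_smul_eq_toAway z
    rw [← map_smul] at hz
    obtain ⟨v, hv⟩ := (Submodule.Quotient.mk_eq_zero _).1 hz
    obtain ⟨n, v', hv'⟩ := hdiv m w v (hφ (by
      rw [map_smul, map_smul, hv]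
      change y • toAway x F w = _
      rw [← hw, smul_comm]))
    refine ⟨n, ?_⟩
    rw [← map_smul]
    refine (Submodule.Quotient.mk_eq_zero _).2 ⟨v', away_pow_smul_injective (f := x) m ?_⟩
    rw [← map_smul, ← hv', smul_comm (x ^ m), hw, map_smul]
  have hkerpow : ∀ (k : ℕ) (z : Y), y ^ k • z = 0 → ∃ n : ℕ, g ^ n • z = 0 := by
    intro k
    induction k with
    | zero => intro z hz; exact ⟨0, by simpa using hz⟩
    | succ k ih =>
      intro z hz
      rw [pow_succ, mul_smul] at hz
      obtain ⟨n, hn⟩ := ih _ hz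
      rw [smul_comm] at hn
      obtain ⟨l, hl⟩ := hker _ hn
      exact ⟨l + n, by rw [pow_add, mul_smul, hl]⟩
  have hY0 : PowTorsion g (loc I 0 (ModuleCat.of R Y)) := by
    refine PowTorsion.of_ker (C := (⊤ : Submodule R PUnit.{1})) 0 (fun z _ ↦ ?_)
      .of_subsingleton
    obtain ⟨k, hk⟩ := locEval_mem I _ z
    obtain ⟨n, hn⟩ := hkerpow k _ (hk _ (Ideal.pow_mem_pow hy k))
    refine ⟨n, locEval_injective I _ ?_⟩
    rw [map_smul, map_zero]
    exact hn
  have hP := extPowFinite_loc_of_principal (X := Y) (g := g) hy (fun z ↦ by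
    obtain ⟨z, rfl⟩ := Submodule.mkQ_surjective _ z
    obtain ⟨m, w, hw⟩ := exists_pow_smul_eq_toAway z
    obtain ⟨k, n, h⟩ := exists_pow_mul_mem_span_pair hI m
    refine ⟨k, n, fun a ha ↦ ?_⟩
    obtain ⟨r, s, hrs⟩ := Ideal.mem_span_pair.1 (h a ha)
    have h0 : x ^ m • (LinearMap.range φ).mkQ z = 0 := by
      rw [← map_smul]
      exact (Submodule.Quotient.mk_eq_zero _).2 ⟨w, hw.symm⟩
    rw [smul_smul, ← hrs, add_smul, mul_smul, h0, smul_zero, zero_add, mul_smul]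
    exact Submodule.smul_mem _ _ (Submodule.mem_span_singleton_self _)) hY (.of_powTorsion hY0)
  exact ⟨loc_zero_eq_zero ex hφ (Submodule.mkQ_surjective _) hL, hY0.of_equiv (shift 0).some,
    .of_equiv (shift 1).some hP.1, fun j ↦ (hP.2 j).of_equiv (shift (j + 2)).some⟩

end PrincipalCriterion

section RegularPair
variable {R : Type u} [CommRing R] [IsNoetherianRing R] {I : Ideal R} {g : R}

lemma extPowFinite_loc_of_killed {M : Type u} [AddCommGroup M] [Module R M] [Module.Finite R M]
    {x y : R} (hy : y ∈ I) (hM : ∀ v : M, x • v = 0)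
    (hI : ∃ k n : ℕ, ∀ a ∈ I ^ k, g ^ n * a ∈ Ideal.span {x, y}) :
    ExtPowFinite I g (loc I 1 (ModuleCat.of R M)) ∧
      ∀ j, PowTorsion g (loc I (j + 2) (ModuleCat.of R M)) := by
  refine extPowFinite_loc_of_finite hy fun v ↦ ?_
  obtain ⟨k, n, h⟩ := hI
  refine ⟨k, n, fun a ha ↦ ?_⟩
  obtain ⟨r, s, hrs⟩ := Ideal.mem_span_pair.1 (h a ha)
  rw [smul_smul, ← hrs, add_smul, mul_smul, hM, smul_zero, zero_add, mul_smul]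
  exact Submodule.smul_mem _ _ (Submodule.mem_span_singleton_self _)

section
variable {S : ShortComplex (ModuleCat.{u} R)} (hS : S.ShortExact)
include hS

lemma extPowFinite_loc_mid {j : ℕ}
    (hker : ∀ v, locHom I S.f j v = 0 → ∃ n : ℕ, g ^ n • v = 0)
    (h1 : ExtPowFinite I g (loc I j S.X₁)) (h3 : ExtPowFinite I g (loc I j S.X₃))
    (h1' : PowTorsion g (loc I (j + 1) S.X₁)) : ExtPowFinite I g (loc I j S.X₂) := by
  refine .of_exact (A := loc I j S.X₁) (B := loc I j S.X₂) (C := loc I j S.X₃) _ _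
    (loc_exact₂ I hS j) hker (fun z ↦ ?_) h1 h3
  obtain ⟨n, hn⟩ := h1' (locδ I hS j z)
  exact ⟨n, (loc_exact₃ I hS j _).1 ((map_smul _ _ _).trans hn)⟩

lemma extPowFinite_loc_left {j : ℕ}
    (h2 : PowTorsion g (loc I j S.X₂))
    (h3 : ExtPowFinite I g (loc I j S.X₃)) (h2' : ExtPowFinite I g (loc I (j + 1) S.X₂))
    (hco : ∀ v : loc I (j + 1) S.X₂, ∃ n : ℕ, locHom I S.g (j + 1) (g ^ n • v) = 0) :
    ExtPowFinite I g (loc I (j + 1) S.X₁) := by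
  refine .of_exact (A := loc I j S.X₃) (B := loc I (j + 1) S.X₁) (C := loc I (j + 1) S.X₂) _ _
    (loc_exact₁ I hS j) (fun z hz ↦ ?_) (fun z ↦ ?_) h3 h2'
  · obtain ⟨v, rfl⟩ := (loc_exact₃ I hS j z).1 hz
    obtain ⟨n, hn⟩ := h2 v
    exact ⟨n, by rw [← map_smul, hn, map_zero]⟩
  · obtain ⟨n, hn⟩ := hco z
    exact ⟨n, (loc_exact₂ I hS (j + 1) _).1 hn⟩

end

theorem extPowFinite_loc_of_regular_pair {M F : Type u} [AddCommGroup M] [Module R M]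
    [Module.Finite R M] [AddCommGroup F] [Module R F] [Module.Finite R F] {x y : R}
    (hx : x ∈ I) (hy : y ∈ I) (hxF : Function.Injective (fun v : F ↦ x • v))
    (hxy : ∀ v w : F, y • v = x • w → ∃ (n : ℕ) (v' : F), g ^ n • v = x • v')
    (hI : ∃ k n : ℕ, ∀ a ∈ I ^ k, g ^ n * a ∈ Ideal.span {x, y}) (φ : M →ₗ[R] F)
    (hker : ∀ v, φ v = 0 → x • v = 0) (hco : ∀ v, x • v ∈ LinearMap.range φ) (j : ℕ) :
    ExtPowFinite I g (loc I j (ModuleCat.of R M)) := by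
  have ex1 : Function.Exact (LinearMap.ker φ).subtype φ.rangeRestrict := by
    intro x
    rw [Submodule.coe_subtype, Subtype.range_coe]
    exact ⟨fun hb ↦ congrArg Subtype.val hb, fun hb ↦ Subtype.ext hb⟩
  have s1 := sesComplex_shortExact ex1 (Submodule.subtype_injective _) φ.surjective_rangeRestrict
  have ex2 := LinearMap.exact_subtype_mkQ (LinearMap.range φ)
  have s2 := sesComplex_shortExact ex2 (Submodule.subtype_injective _) (Submodule.mkQ_surjective _)
  obtain ⟨hF0, hF1, hF2, hF3⟩ := loc_of_regular_pair hx hy hxF hxy hI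
  have hK := extPowFinite_loc_of_killed (M := LinearMap.ker φ) (g := g) hy
    (fun v ↦ Subtype.ext (hker v v.2)) hI
  have hC := extPowFinite_loc_of_killed (M := F ⧸ LinearMap.range φ) (g := g) hy (fun v ↦ by
    obtain ⟨v, rfl⟩ := Submodule.mkQ_surjective _ v
    rw [← map_smul]
    exact (Submodule.Quotient.mk_eq_zero _).2 (hco v)) hI
  have hF0' : PowTorsion g (loc I 0 (ModuleCat.of R F)) := fun v ↦ ⟨0, by rw [hF0 v, smul_zero]⟩
  have hM0 : ∀ v : loc I 0 (ModuleCat.of R (LinearMap.range φ)), v = 0 := fun v ↦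
    loc_zero_injective I s2 ((hF0 _).trans (map_zero _).symm)
  have hM1 : ExtPowFinite I g (loc I 1 (ModuleCat.of R (LinearMap.range φ))) := by
    refine extPowFinite_loc_left s2 hF0' .loc_zero_of_finite (.of_powTorsion hF1) fun v ↦ ?_
    obtain ⟨n, hn⟩ := hF1 v
    exact ⟨n, (congrArg _ hn).trans (map_zero _)⟩
  have hM2 : ExtPowFinite I g (loc I 2 (ModuleCat.of R (LinearMap.range φ))) := by
    refine extPowFinite_loc_left s2 hF1 hC.1 hF2 fun v ↦ ?_
    obtain ⟨n, hn⟩ := hC.2 0 (locHom I _ 2 v)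
    exact ⟨n, (map_smul _ _ _).trans hn⟩
  have hM3 : ∀ j, PowTorsion g (loc I (j + 3) (ModuleCat.of R (LinearMap.range φ))) := fun j ↦
    .of_exact (loc_exact₁ I s2 (j + 2)) (hC.2 j) (hF3 j)
  match j with
  | 0 => exact .loc_zero_of_finite
  | 1 =>
    refine extPowFinite_loc_mid s1 (fun v hv ↦ ⟨0, ?_⟩) hK.1 hM1 (hK.2 0)
    obtain ⟨w, rfl⟩ := (loc_exact₁ I s1 0 v).1 hv
    rw [pow_zero, one_smul]
    exact (congrArg _ (hM0 w)).trans (map_zero _)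
  | 2 => exact extPowFinite_loc_mid s1 (fun v _ ↦ hK.2 0 v) (.of_powTorsion (hK.2 0)) hM2 (hK.2 1)
  | j + 3 =>
    exact .of_powTorsion (.of_exact (loc_exact₂ I s1 (j + 3)) (hK.2 (j + 1)) (hM3 j))

end RegularPair

section Descent
variable {R S : Type*} [CommRing R] [CommRing S] [Algebra R S] [Module.FaithfullyFlat R S]

lemma dvd_of_algebraMap_dvd {a b : R} (h : algebraMap R S a ∣ algebraMap R S b) : a ∣ b := by
  rw [← Ideal.mem_span_singleton] at h ⊢
  rw [← Ideal.comap_map_eq_self_of_faithfullyFlat (B := S) (Ideal.span {a}), Ideal.mem_comap,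
    Ideal.map_span, Set.image_singleton]
  exact h

/-- Unique factorization descends along faithfully flat maps from a Noetherian ring to a local
ring. -/
theorem isDomain_and_uniqueFactorizationMonoid_of_faithfullyFlat
    [IsNoetherianRing R] [IsLocalRing S] [IsDomain S] [UniqueFactorizationMonoid S] :
    IsDomain R ∧ UniqueFactorizationMonoid R := by
  have hinj : Function.Injective (algebraMap R S) := FaithfulSMul.algebraMap_injective R S
  have : IsDomain R := hinj.isDomain _
  refine ⟨this, ⟨fun {p} ↦ ⟨fun hp ↦ ⟨hp.ne_zero, hp.not_isUnit, fun e a hea ↦ ?_⟩,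
    Prime.irreducible⟩⟩⟩
  by_contra! hdvd
  obtain ⟨hpe, ha⟩ := hdvd
  have ha0 : a ≠ 0 := by rintro rfl; exact ha (dvd_zero p)
  let _ := UniqueFactorizationMonoid.toGCDMonoid S
  obtain ⟨γ, α, d, hrel, hγ, hα⟩ := UniqueFactorizationMonoid.exists_reduced_factors
    (algebraMap R S p) (by simpa using hp.ne_zero) (algebraMap R S a)
  have hd : d ≠ 0 := by
    rintro rfl
    rw [zero_mul, eq_comm, map_eq_zero_iff _ hinj] at hγ
    exact hp.ne_zero hγ
  have key (c : R) (hc : p ∣ c * a) : γ ∣ algebraMap R S c := by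
    obtain ⟨b, hb⟩ := hc
    have := congrArg (algebraMap R S) hb
    rw [map_mul, map_mul, ← hγ, ← hα, mul_left_comm, mul_assoc] at this
    exact hrel.dvd_of_dvd_mul_right ⟨_, mul_left_cancel₀ hd this⟩
  obtain ⟨k, A, y, hy, hA⟩ := Module.Flat.isTrivialRelation_of_sum_smul_eq_zero
    (f := ![a, p]) (x := ![γ, -α]) (by
      simp only [Fin.sum_univ_two, Matrix.cons_val_zero, Matrix.cons_val_one, Algebra.smul_def]
      rw [← hγ, ← hα]
      ring)
  have hy0 := hy 0
  simp only [Matrix.cons_val_zero] at hy0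
  have hA' (j) : p ∣ A 0 j * a := by
    have := hA j
    simp only [Fin.sum_univ_two, Matrix.cons_val_zero, Matrix.cons_val_one] at this
    exact ⟨-A 1 j, by linear_combination this⟩
  choose s hs using fun j ↦ key _ (hA' j)
  have hγ0 : γ ≠ 0 := by
    rintro rfl
    rw [mul_zero, eq_comm, map_eq_zero_iff _ hinj] at hγ
    exact hp.ne_zero hγ
  have h1 : ∑ j, s j * y j = 1 := by
    refine mul_left_cancel₀ hγ0 ?_
    rw [mul_one, Finset.mul_sum]
    refine (Finset.sum_congr rfl fun j _ ↦ ?_).trans hy0.symm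
    rw [Algebra.smul_def, hs, mul_assoc]
  obtain ⟨j, -, hj⟩ := IsLocalRing.exists_of_isUnit_sum (h1 ▸ isUnit_one)
  have hj := isUnit_of_mul_isUnit_left hj
  have hc (c : R) (hc : p ∣ c * a) : A 0 j ∣ c := by
    refine dvd_of_algebraMap_dvd (S := S) ?_
    rw [hs, hj.mul_right_dvd]
    exact key c hc
  obtain ⟨q, hq⟩ := hc p (dvd_mul_right p a)
  rcases hp.isUnit_or_isUnit hq with hu | hu
  · exact ha (by simpa [hu.dvd_mul_left] using hA' j)
  · exact hpe ((by rw [hq, hu.mul_right_dvd] : p ∣ A 0 j).trans (hc e hea))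

end Descent

lemma isDomain_and_uniqueFactorizationMonoid_of_adicCompletion (R : Type u) [CommRing R]
    [IsNoetherianRing R] [IsLocalRing R]
    [IsDomain (AdicCompletion (IsLocalRing.maximalIdeal R) R)]
    [UniqueFactorizationMonoid (AdicCompletion (IsLocalRing.maximalIdeal R) R)] :
    IsDomain R ∧ UniqueFactorizationMonoid R := by
  have : IsLocalHom (algebraMap R (AdicCompletion (IsLocalRing.maximalIdeal R) R)) :=
    AdicCompletion.algebraMap_isLocalHom_of_fg (IsNoetherian.noetherian _)
  have : Module.Flat R (AdicCompletion (IsLocalRing.maximalIdeal R) R) :=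
    AdicCompletion.flat_of_isNoetherian _
  have : Module.FaithfullyFlat R (AdicCompletion (IsLocalRing.maximalIdeal R) R) :=
    Module.FaithfullyFlat.of_flat_of_isLocalHom
  exact isDomain_and_uniqueFactorizationMonoid_of_faithfullyFlat
    (S := AdicCompletion (IsLocalRing.maximalIdeal R) R)

section FactorialRing

lemma exists_notMem_forall_mem_pow {R : Type*} [CommRing R] [IsNoetherianRing R] {J Q : Ideal R}
    (hQ : Q ∈ J.minimalPrimes) : ∃ g ∉ Q, ∃ k : ℕ, ∀ a ∈ Q ^ k, g * a ∈ J := by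
  have hp : Q.IsPrime := hQ.1.1
  have hfin := (J.finite_minimalPrimes_of_isNoetherianRing R).subset
    (Set.sdiff_subset (t := {Q}))
  have h : ¬ hfin.toFinset.inf id ≤ Q := by
    rw [hp.inf_le']
    rintro ⟨P, hP, hPQ⟩
    rw [Set.Finite.mem_toFinset] at hP
    exact hP.2 (le_antisymm hPQ (hQ.2 hP.1.1 hPQ))
  obtain ⟨g, hg, hgQ⟩ := SetLike.not_le_iff_exists.1 h
  have hle : Ideal.span {g} * Q ≤ J.radical := by
    rw [← Ideal.sInf_minimalPrimes, Ideal.span_singleton_mul_le_iff]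
    intro q hq
    rw [Submodule.mem_sInf]
    intro P hP
    by_cases hPQ : P = Q
    · exact hPQ ▸ Ideal.mul_mem_left _ _ hq
    · refine Ideal.mul_mem_right _ _ ?_
      exact (Finset.inf_le (f := id) (hfin.mem_toFinset.2 ⟨hP, hPQ⟩)) hg
  obtain ⟨k, hk⟩ := Ideal.exists_pow_le_of_le_radical_of_fg hle (IsNoetherian.noetherian _)
  refine ⟨g ^ k, fun h ↦ hgQ (hp.mem_of_pow_mem _ h), k, fun a ha ↦ hk ?_⟩
  rw [mul_pow, Ideal.span_singleton_pow]
  exact Ideal.mul_mem_mul (Ideal.mem_span_singleton_self _) ha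

variable {R : Type*} [CommRing R]

lemma multiset_prod_dvd_of_dvd_mul [IsDomain R] {s : Multiset R} {y v : R} (hs : ∀ p ∈ s, Prime p)
    (hy : ∀ p ∈ s, ¬ p ∣ y) (h : s.prod ∣ y * v) : s.prod ∣ v := by
  induction s using Multiset.induction_on generalizing v with
  | empty => simp
  | cons p t ih =>
    rw [Multiset.prod_cons] at h ⊢
    obtain ⟨w, rfl⟩ := ih (fun q hq ↦ hs q (Multiset.mem_cons_of_mem hq))
      (fun q hq ↦ hy q (Multiset.mem_cons_of_mem hq)) ((dvd_mul_left _ _).trans h)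
    have ht : t.prod ≠ 0 :=
      Multiset.prod_ne_zero fun h0 ↦ (hs 0 (Multiset.mem_cons_of_mem h0)).ne_zero rfl
    rw [mul_left_comm, mul_comm p, mul_dvd_mul_iff_left ht] at h
    rw [mul_comm p, mul_dvd_mul_iff_left ht]
    exact ((hs p (Multiset.mem_cons_self p t)).dvd_or_dvd h).resolve_left
      (hy p (Multiset.mem_cons_self p t))

variable [UniqueFactorizationMonoid R]

lemma exists_notMem_mul_prod (Q : Ideal R) [Q.IsPrime] {x : R} (hx : x ≠ 0) :
    ∃ h ∉ Q, ∃ s : Multiset R, (∀ p ∈ s, Prime p ∧ p ∈ Q) ∧ x = h * s.prod := by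
  induction x using UniqueFactorizationMonoid.induction_on_prime with
  | h₁ => exact absurd rfl hx
  | h₂ x hu =>
    exact ⟨x, fun h ↦ ‹Q.IsPrime›.ne_top (Ideal.eq_top_of_isUnit_mem _ h hu), 0, by simp, by simp⟩
  | h₃ a p ha hp ih =>
    obtain ⟨h, hh, s, hs, rfl⟩ := ih ha
    by_cases hpQ : p ∈ Q
    · refine ⟨h, hh, p ::ₘ s, fun q hq ↦ ?_, by rw [Multiset.prod_cons, mul_left_comm]⟩
      rcases Multiset.mem_cons.1 hq with rfl | hq
      exacts [⟨hp, hpQ⟩, hs q hq]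
    · exact ⟨p * h, fun h' ↦ (‹Q.IsPrime›.mem_or_mem h').elim hpQ hh, s, hs, by rw [mul_assoc]⟩

lemma exists_common_divisor {I : Ideal R} (hI : I ≠ ⊥) :
    ∃ d : R, d ≠ 0 ∧ (∀ a ∈ I, d ∣ a) ∧ ∀ p, Prime p → ∃ a, d * a ∈ I ∧ ¬ p ∣ a := by
  obtain ⟨x, hxI, hx⟩ := Submodule.exists_mem_ne_zero_of_ne_bot hI
  obtain ⟨e, ⟨d, rfl, hd⟩, hmin⟩ := (IsWellFounded.wf (r := DvdNotUnit (α := R))).has_min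
    {e | ∃ d, x = d * e ∧ ∀ a ∈ I, d ∣ a} ⟨x, 1, (one_mul x).symm, fun a _ ↦ one_dvd a⟩
  have hd0 := left_ne_zero_of_mul hx
  refine ⟨d, hd0, hd, fun p hp ↦ ?_⟩
  by_contra! h
  obtain ⟨e', rfl⟩ := h e hxI
  refine hmin e' ⟨d * p, by rw [mul_assoc], fun a ha ↦ ?_⟩
    ⟨right_ne_zero_of_mul (right_ne_zero_of_mul hx), p, hp.not_isUnit, mul_comm _ _⟩
  obtain ⟨a, rfl⟩ := hd a ha
  exact mul_dvd_mul_left d (h a ha)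

variable [IsDomain R] [IsNoetherianRing R] {I Q : Ideal R} [Q.IsPrime]

lemma exists_regular_pair (hIQ : I ≤ Q)
    (hQ : ∀ P₁ P₂ : Ideal R, P₁.IsPrime → P₂.IsPrime → ⊥ < P₁ → P₁ < P₂ → ¬ P₂ < Q)
    (hI : ∀ p ∈ Q, Prime p → ∃ a ∈ I, ¬ p ∣ a) {x : R} (hx : x ≠ 0) :
    ∃ y ∈ I, ∃ g ∉ Q, (∀ v, x ∣ y * v → x ∣ g * v) ∧
      ∃ k : ℕ, ∀ a ∈ Q ^ k, g * a ∈ Ideal.span {x, y} := by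
  classical
  by_cases hxQ : x ∈ Q
  swap
  · exact ⟨0, zero_mem _, x, hxQ, fun v _ ↦ dvd_mul_right x v, 0, fun a _ ↦
      Ideal.mul_mem_right _ _ (Ideal.subset_span (by simp))⟩
  obtain ⟨h, hh, s, hs, rfl⟩ := exists_notMem_mul_prod Q hx
  have hav : ¬ (I : Set R) ⊆ ⋃ p ∈ (s.toFinset : Set R), (Ideal.span {p} : Set R) := by
    rw [Ideal.subset_union_prime 0 0 fun p hp _ _ ↦ ?_]
    · rintro ⟨p, hp, hle⟩
      obtain ⟨hp, hpQ⟩ := hs p (Multiset.mem_toFinset.1 hp)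
      obtain ⟨a, ha, hpa⟩ := hI p hpQ hp
      exact hpa (Ideal.mem_span_singleton.1 (hle ha))
    · have := (hs p (Multiset.mem_toFinset.1 hp)).1
      exact (Ideal.span_singleton_prime this.ne_zero).2 this
  obtain ⟨y, hyI, hy⟩ := Set.not_subset.1 hav
  simp only [Set.mem_iUnion, not_exists, SetLike.mem_coe, Ideal.mem_span_singleton,
    Multiset.mem_toFinset] at hy
  have hmin : Q ∈ (Ideal.span {h * s.prod, y}).minimalPrimes := by
    have hle : Ideal.span {h * s.prod, y} ≤ Q := by
      rw [Ideal.span_le, Set.pair_subset_iff]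
      exact ⟨hxQ, hIQ hyI⟩
    obtain ⟨P, hP, hPQ⟩ := Ideal.exists_minimalPrimes_le hle
    rcases hPQ.eq_or_lt with rfl | hlt
    · exact hP
    exfalso
    have hPp : P.IsPrime := hP.1.1
    have hxP : h * s.prod ∈ P := hP.1.2 (Ideal.subset_span (by simp))
    have hyP : y ∈ P := hP.1.2 (Ideal.subset_span (by simp))
    obtain ⟨p, hps, hpP⟩ := (hPp.multiset_prod_mem_iff_exists_mem s).1
      ((hPp.mem_or_mem hxP).resolve_left fun h' ↦ hh (hPQ h'))
    have hp := (hs p hps).1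
    refine hQ (Ideal.span {p}) P ((Ideal.span_singleton_prime hp.ne_zero).2 hp) hPp ?_ ?_ hlt
    · rw [bot_lt_iff_ne_bot, Ne, Ideal.span_singleton_eq_bot]
      exact hp.ne_zero
    · refine lt_of_le_of_ne ((Ideal.span_singleton_le_iff_mem P).2 hpP) ?_
      rintro rfl
      exact hy p hps (Ideal.mem_span_singleton.1 hyP)
  obtain ⟨g, hg, k, hk⟩ := exists_notMem_forall_mem_pow hmin
  refine ⟨y, hyI, h * g, fun h' ↦ (‹Q.IsPrime›.mem_or_mem h').elim hh hg, fun v hv ↦ ?_, k,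
    fun a ha ↦ by rw [mul_assoc]; exact Ideal.mul_mem_left _ _ (hk a ha)⟩
  rw [mul_assoc]
  exact mul_dvd_mul_left h ((multiset_prod_dvd_of_dvd_mul (fun p hp ↦ (hs p hp).1)
    (fun p hp ↦ hy p hp) ((dvd_mul_left _ _).trans hv)).mul_left g)

lemma exists_notMem_principal_or_regular_pair (hIQ : I ≤ Q)
    (hQ : ∀ P₁ P₂ : Ideal R, P₁.IsPrime → P₂.IsPrime → ⊥ < P₁ → P₁ < P₂ → ¬ P₂ < Q)
    {b : R} (hb : b ≠ 0) :
    ∃ g ∉ Q, (∃ f ∈ I, ∃ k n : ℕ, ∀ a ∈ I ^ k, f ∣ g ^ n * a) ∨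
      ∃ x ∈ I, ∃ y ∈ I, x ≠ 0 ∧ b ∣ x ∧ (∀ v, x ∣ y * v → x ∣ g * v) ∧
        ∃ k n : ℕ, ∀ a ∈ I ^ k, g ^ n * a ∈ Ideal.span {x, y} := by
  by_cases hI : I = ⊥
  · refine ⟨1, ‹Q.IsPrime›.one_notMem, .inl ⟨0, zero_mem _, 1, 0, fun a ha ↦ ?_⟩⟩
    rw [pow_one, hI, Ideal.mem_bot] at ha
    simp [ha]
  obtain ⟨d, hd, hdI, hdp⟩ := exists_common_divisor hI
  obtain ⟨x, hxI, hx⟩ := Submodule.exists_mem_ne_zero_of_ne_bot hI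
  by_cases hIQ' : ∃ s, d * s ∈ I ∧ s ∉ Q
  · obtain ⟨s, hs, hsQ⟩ := hIQ'
    refine ⟨s, hsQ, .inl ⟨_, hs, 1, 1, fun a ha ↦ ?_⟩⟩
    obtain ⟨a, rfl⟩ := hdI a (by simpa using ha)
    exact ⟨a, by ring⟩
  push Not at hIQ'
  by_cases hdQ : d ∈ Q
  · obtain ⟨y, hy, g, hg, -, k, hk⟩ := exists_regular_pair
      (I := Submodule.comap (LinearMap.mulLeft R d) I) (x := x) (fun s hs ↦ hIQ' s hs) hQ
      (fun p _ hp ↦ hdp p hp) hx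
    refine ⟨g, hg, .inl ⟨d * (g * d ^ k), ?_, k + 1, 1, fun a ha ↦ ?_⟩⟩
    · have hle : Ideal.span {x, y} ≤ Submodule.comap (LinearMap.mulLeft R d) I := by
        rw [Ideal.span_le, Set.pair_subset_iff]
        exact ⟨Ideal.mul_mem_left _ _ hxI, hy⟩
      exact hle (hk _ (Ideal.pow_mem_pow hdQ k))
    · have hle : I ≤ Ideal.span {d} := fun a ha ↦ Ideal.mem_span_singleton.2 (hdI a ha)
      have := Ideal.pow_right_mono hle (k + 1) ha
      rw [Ideal.span_singleton_pow, Ideal.mem_span_singleton] at this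
      obtain ⟨c, rfl⟩ := this
      exact ⟨c, by ring⟩
  · obtain ⟨y, hy, g, hg, hxy, k, hk⟩ := exists_regular_pair (I := I) (x := b * x) hIQ hQ
      (fun p hpQ hp ↦ by
        obtain ⟨a, ha, hpa⟩ := hdp p hp
        refine ⟨_, ha, fun h ↦ (hp.dvd_or_dvd h).elim (fun h ↦ hdQ ?_) hpa⟩
        exact Ideal.mem_of_dvd _ h hpQ) (mul_ne_zero hb hx)
    exact ⟨g, hg, .inr ⟨b * x, Ideal.mul_mem_left _ _ hxI, y, hy, mul_ne_zero hb hx,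
      dvd_mul_right b x, hxy, k, 1, fun a ha ↦ by
        rw [pow_one]; exact hk a (Ideal.pow_right_mono hIQ k ha)⟩⟩

end FactorialRing

section FactorialLocal
variable {R : Type u} [CommRing R] [IsDomain R]

lemma exists_linearMap_pi (M : Type u) [AddCommGroup M] [Module R M] [Module.Finite R M] :
    ∃ (ι : Type) (_ : Finite ι) (φ : M →ₗ[R] ι → R) (b : R), b ≠ 0 ∧
      (∀ v, φ v = 0 → b • v = 0) ∧ ∀ w : ι → R, b • w ∈ LinearMap.range φ := by
  classical
  obtain ⟨n, v, hv⟩ := Module.Finite.exists_fin (R := R) (M := M)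
  obtain ⟨s, hs, hs'⟩ := exists_maximal_linearIndepOn R v
  choose! a ha0 ha using hs'
  let a' : Fin n → R := fun i ↦ if i ∈ s then 1 else a i
  have ha' (i) : a' i ≠ 0 ∧ a' i • v i ∈ Submodule.span R (Set.range fun i : s ↦ v i) := by
    rw [← Set.image_eq_range]
    by_cases hi : i ∈ s
    · simpa [a', hi] using Submodule.subset_span (Set.mem_image_of_mem v hi)
    · simpa [a', hi] using ⟨ha0 i hi, ha i hi⟩
  have hb (m : M) : (∏ i, a' i) • m ∈ Submodule.span R (Set.range fun i : s ↦ v i) := by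
    have : (⊤ : Submodule R M) ≤ (Submodule.span R (Set.range fun i : s ↦ v i)).comap
        (LinearMap.lsmul R M (∏ i, a' i)) := by
      rw [← hv, Submodule.span_le, Set.range_subset_iff]
      intro i
      obtain ⟨c, hc⟩ := Finset.dvd_prod_of_mem a' (Finset.mem_univ i)
      rw [SetLike.mem_coe, Submodule.mem_comap, LinearMap.lsmul_apply, hc, mul_comm, mul_smul]
      exact Submodule.smul_mem _ _ (ha' i).2
    exact this Submodule.mem_top
  let e := hs.linearCombinationEquiv.symm ≪≫ₗ Finsupp.linearEquivFunOnFinite R R s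
  refine ⟨s, inferInstance, e.toLinearMap ∘ₗ (LinearMap.lsmul R M (∏ i, a' i)).codRestrict _ hb,
    ∏ i, a' i, Finset.prod_ne_zero_iff.2 fun i _ ↦ (ha' i).1, fun m hm ↦ ?_, fun w ↦ ?_⟩
  · exact congrArg Subtype.val (e.map_eq_zero_iff.1 hm)
  · obtain ⟨u, rfl⟩ := e.surjective w
    exact ⟨u, (congrArg e (Subtype.ext rfl)).trans (map_smul e _ u)⟩

variable [IsNoetherianRing R] [UniqueFactorizationMonoid R]

theorem exists_extPowFinite_loc {I Q : Ideal R} [Q.IsPrime] (hIQ : I ≤ Q)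
    (hQ : ∀ P₁ P₂ : Ideal R, P₁.IsPrime → P₂.IsPrime → ⊥ < P₁ → P₁ < P₂ → ¬ P₂ < Q)
    (M : Type u) [AddCommGroup M] [Module R M] [Module.Finite R M] :
    ∃ g ∉ Q, ∀ j, ExtPowFinite I g (loc I j (ModuleCat.of R M)) := by
  obtain ⟨ι, _, φ, b, hb, hker, hco⟩ := exists_linearMap_pi (R := R) M
  obtain ⟨g, hg, h⟩ := exists_notMem_principal_or_regular_pair hIQ hQ hb
  refine ⟨g, hg, ?_⟩
  rcases h with ⟨f, hf, hI⟩ | ⟨x, hx, y, hy, hx0, ⟨c, rfl⟩, hxy, hI⟩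
  · exact fun j ↦ extPowFinite_loc_of_principal_of_finite hf hI j
  · refine fun j ↦ extPowFinite_loc_of_regular_pair hx hy ?_ (fun v w hvw ↦ ?_) hI φ
      (fun v hv ↦ by rw [mul_comm, mul_smul, hker v hv, smul_zero]) (fun w ↦ ?_) j
    · exact fun v w hvw ↦ funext fun i ↦ mul_left_cancel₀ hx0 (congrFun hvw i)
    · have hd (i) : b * c ∣ g * v i := hxy _ ⟨w i, congrFun hvw i⟩
      choose v' hv' using hd
      exact ⟨1, v', funext fun i ↦ by simpa using hv' i⟩
    · rw [mul_comm, mul_smul]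
      exact Submodule.smul_mem _ _ (hco w)

end FactorialLocal

section Finiteness
variable {R : Type u} [CommRing R] [IsNoetherianRing R]

lemma finite_of_forall_exists_chain [IsDomain R] [IsLocalRing R] (hdim : ringKrullDim R ≤ 4)
    (J : Ideal R) (hJ : ∀ Q : Ideal R, Q.IsPrime → J ≤ Q →
      ∃ P₁ P₂ : Ideal R, P₁.IsPrime ∧ P₂.IsPrime ∧ ⊥ < P₁ ∧ P₁ < P₂ ∧ P₂ < Q) :
    {Q : Ideal R | Q.IsPrime ∧ J ≤ Q}.Finite := by
  refine ((J.finite_minimalPrimes_of_isNoetherianRing R).union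
    (Set.finite_singleton (IsLocalRing.maximalIdeal R))).subset fun Q ⟨hQ, hJQ⟩ ↦ ?_
  obtain ⟨P, hP, hPQ⟩ := Ideal.exists_minimalPrimes_le hJQ
  rcases hPQ.eq_or_lt with rfl | hlt
  · exact .inl hP
  refine .inr ?_
  by_contra hQm
  have hQm : Q < IsLocalRing.maximalIdeal R :=
    lt_of_le_of_ne (IsLocalRing.le_maximalIdeal hQ.ne_top) hQm
  have hPp : P.IsPrime := hP.1.1
  obtain ⟨P₁, P₂, h₁, h₂, h01, h12, h23⟩ := hJ P hPp hP.1.2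
  let c : LTSeries (PrimeSpectrum R) := ⟨5, ![⟨⊥, Ideal.isPrime_bot⟩, ⟨P₁, h₁⟩, ⟨P₂, h₂⟩,
    ⟨P, hPp⟩, ⟨Q, hQ⟩, ⟨IsLocalRing.maximalIdeal R, inferInstance⟩], fun i ↦ by
      fin_cases i
      exacts [h01, h12, h23, hlt, hQm]⟩
  have h := (Order.LTSeries.length_le_krullDim c).trans hdim
  have : ((5 : ℕ) : WithBot ℕ∞) ≤ ((4 : ℕ) : WithBot ℕ∞) := h
  norm_cast at this

lemma finite_associatedPrimes_of_powFinite [IsDomain R] [IsLocalRing R]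
    (hdim : ringKrullDim R ≤ 4) {L : Type*} [AddCommGroup L] [Module R L]
    (h : ∀ Q : Ideal R, Q.IsPrime → (∀ g ∉ Q, ¬ PowFinite g L) →
      ∃ P₁ P₂ : Ideal R, P₁.IsPrime ∧ P₂.IsPrime ∧ ⊥ < P₁ ∧ P₁ < P₂ ∧ P₂ < Q) :
    (associatedPrimes R L).Finite := by
  obtain ⟨S, hS, hspan⟩ := (Submodule.fg_span_iff_fg_span_finset_subset {g : R | PowFinite g L}).1
    (IsNoetherian.noetherian (Ideal.span {g : R | PowFinite g L}))
  refine ((finite_of_forall_exists_chain hdim _ fun Q hQ hle ↦ h Q hQ fun g hg hgL ↦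
    hg (hle (Ideal.subset_span hgL))).union
    (S.finite_toSet.biUnion fun g hg ↦ (hS hg).finite_associatedPrimes)).subset fun P hP ↦ ?_
  by_cases hle : Ideal.span {g : R | PowFinite g L} ≤ P
  · exact .inl ⟨hP.isPrime, hle⟩
  · refine .inr ?_
    rw [Ideal.span, hspan, Submodule.span_le, Set.not_subset] at hle
    obtain ⟨g, hg, hgP⟩ := hle
    exact Set.mem_biUnion hg ⟨hP, hgP⟩

variable [IsDomain R] [UniqueFactorizationMonoid R] [IsLocalRing R]

theorem finite_associatedPrimes_ext_loc (hdim : ringKrullDim R ≤ 4) (I : Ideal R)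
    (M N : Type u) [AddCommGroup M] [Module R M] [Module.Finite R M] [AddCommGroup N] [Module R N]
    [Module.Finite R N] (hN : ∃ k, I ^ k ≤ Module.annihilator R N) (i j : ℕ) :
    (associatedPrimes R
      (Abelian.Ext (ModuleCat.of R N) (loc I j (ModuleCat.of R M)) i)).Finite := by
  refine finite_associatedPrimes_of_powFinite hdim fun Q hQ hg ↦ ?_
  by_contra! h
  by_cases hIQ : I ≤ Q
  · obtain ⟨g, hgQ, hext⟩ := exists_extPowFinite_loc hIQ
      (fun P₁ P₂ h₁ h₂ h01 h12 h2Q ↦ h P₁ P₂ h₁ h₂ h01 h12 h2Q) M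
    exact hg g hgQ (hext j N hN i)
  · obtain ⟨g, hgI, hgQ⟩ := SetLike.not_le_iff_exists.1 hIQ
    refine hg g hgQ (powTorsion_ext (A := loc I j (ModuleCat.of R M)) (fun x ↦ ?_) i N).powFinite
    have hx : x ∈ powTorsionPart I (loc I j (ModuleCat.of R M)) :=
      (powTorsionPart_loc I j (ModuleCat.of R M)).symm ▸ Submodule.mem_top
    obtain ⟨k, hk⟩ := hx
    exact ⟨k, hk _ (Ideal.pow_mem_pow hgI k)⟩

theorem finite_associatedPrimes_loc (hdim : ringKrullDim R ≤ 4) (I : Ideal R)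
    (M : Type u) [AddCommGroup M] [Module R M] [Module.Finite R M] (j : ℕ) :
    (associatedPrimes R (loc I j (ModuleCat.of R M))).Finite := by
  refine (finite_associatedPrimes_ext_loc hdim I M (R ⧸ I)
    ⟨1, by rw [pow_one, Ideal.annihilator_quotient]⟩ 0 j).subset fun P hP ↦ ?_
  obtain ⟨hPp, t, ht⟩ := isAssociatedPrime_iff.1 hP
  have hmem (r : R) : r ∈ P ↔ r • t = 0 := by
    rw [ht, Submodule.mem_colon_singleton, Submodule.mem_bot]
  have htor : t ∈ powTorsionPart I (loc I j (ModuleCat.of R M)) :=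
    (powTorsionPart_loc I j (ModuleCat.of R M)).symm ▸ Submodule.mem_top
  obtain ⟨k, hk⟩ := htor
  have hIP : I ≤ P := hPp.le_of_pow_le fun a ha ↦ (hmem a).2 (hk a ha)
  let f : (R ⧸ I) →ₗ[R] loc I j (ModuleCat.of R M) :=
    Submodule.liftQ I (LinearMap.toSpanSingleton R _ t) fun a ha ↦ (hmem a).1 (hIP ha)
  let e : Abelian.Ext (ModuleCat.of R (R ⧸ I)) (loc I j (ModuleCat.of R M)) 0 ≃ₗ[R]
    ((R ⧸ I) →ₗ[R] loc I j (ModuleCat.of R M)) := Abelian.Ext.linearEquiv₀ ≪≫ₗ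
      ModuleCat.homLinearEquiv
  rw [LinearEquiv.AssociatedPrimes.eq e]
  refine isAssociatedPrime_iff.2 ⟨hPp, f, ?_⟩
  ext r
  rw [hmem, Submodule.mem_colon_singleton, Submodule.mem_bot]
  refine ⟨fun hr ↦ ?_, fun hr ↦ ?_⟩
  · refine Submodule.linearMap_qext _ (LinearMap.ext_ring ?_)
    exact (congrArg (r • ·) (one_smul R t)).trans hr
  · exact (congrArg (r • ·) (one_smul R t)).symm.trans (LinearMap.congr_fun hr
      (Submodule.Quotient.mk 1))

end Finiteness

theorem stmt18 (R : Type u) [CommRing R] [IsNoetherianRing R] [IsLocalRing R]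
    (hdim : ringKrullDim R = 4)
    [IsDomain (AdicCompletion (IsLocalRing.maximalIdeal R) R)]
    [UniqueFactorizationMonoid (AdicCompletion (IsLocalRing.maximalIdeal R) R)]
    (I : Ideal R) (M : Type u) [AddCommGroup M] [Module R M] [Module.Finite R M]
    (N : Type u) [AddCommGroup N] [Module R N] [Module.Finite R N]
    (hN : Module.support R N ⊆ PrimeSpectrum.zeroLocus (I : Set R)) :
    (∀ i j : ℕ,
      (associatedPrimes R
        ↥(((Ext R (ModuleCat.{u} R) i).obj (Opposite.op (ModuleCat.of R N))).obj
          ((localCohomology I j).obj (ModuleCat.of R M)))).Finite) ∧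
    ∀ i : ℕ, (associatedPrimes R ↥((localCohomology I i).obj (ModuleCat.of R M))).Finite := by
  obtain ⟨_, _⟩ := isDomain_and_uniqueFactorizationMonoid_of_adicCompletion R
  have hN' : ∃ k, I ^ k ≤ Module.annihilator R N := by
    rw [Module.support_eq_zeroLocus, PrimeSpectrum.zeroLocus_subset_zeroLocus_iff] at hN
    exact Ideal.exists_pow_le_of_le_radical_of_fg hN (IsNoetherian.noetherian I)
  refine ⟨fun i j ↦ ?_, fun j ↦ ?_⟩
  · obtain ⟨e⟩ := nonempty_localCohomology_equiv I j (ModuleCat.of R M)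
    let e' := (((Ext R (ModuleCat.{u} R) i).obj (Opposite.op (ModuleCat.of R N))).mapIso
      e.toModuleIso).toLinearEquiv
    refine (LinearEquiv.AssociatedPrimes.eq (e'.symm ≪≫ₗ leftDerivedExtEquiv (ModuleCat.of R N)
      (loc I j (ModuleCat.of R M)) i)) ▸ ?_
    exact finite_associatedPrimes_ext_loc hdim.le I M N hN' i j
  · obtain ⟨e⟩ := nonempty_localCohomology_equiv I j (ModuleCat.of R M)
    rw [← LinearEquiv.AssociatedPrimes.eq e]
    exact finite_associatedPrimes_loc hdim.le I M j
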